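/- Fix ξ = (ξ',ξ'') ∈ ℝ^n × ℝ^m with |ξ'| = |ξ''| = 1, let U f(x) = f(x'+ξ', x''+ξ'') and Λ_R f(x',x'') = f(Rx', Rx'') for R > 0. Then for every integer k ≥ 1, every f ∈ C_c^∞(ℝ^{n+m}), and every x ∈ ℝ^{n+m}, one has the pointwise convergence lim_{R→0^+} (Λ_R U) ( ∂^k_{x'_1} (G_{e_1/R})^{−k/2} ) (Λ_R U)^{−1} f(x) = ∂^k_{x'_1} (Δ_{e_1})^{−k/2} f(x). -/

import Mathlib

noncomputable section
open MeasureTheory Real Set Filter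

/-- `ℝ^{n+m}` written as pairs `x = (x', x'')`. -/
abbrev Ep (n m : ℕ) := EuclideanSpace ℝ (Fin n) × EuclideanSpace ℝ (Fin m)

/-- Euclidean dot product. -/
def dotp {n : ℕ} (a b : EuclideanSpace ℝ (Fin n)) : ℝ := ∑ i, a i * b i

/-- The measure `dμ_a = e^{2a·x'} dx` on `ℝ^{n+m}`. -/
def muG {n m : ℕ} (a : EuclideanSpace ℝ (Fin n)) : Measure (Ep n m) :=
  volume.withDensity fun x => ENNReal.ofReal (Real.exp (2 * dotp a x.1))

/-- Scaled Hermite heat kernel `k_{t,λ}(x',y')`. -/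
def hermiteK (n : ℕ) {m : ℕ} (t : ℝ) (lam : EuclideanSpace ℝ (Fin m))
    (x' y' : EuclideanSpace ℝ (Fin n)) : ℝ :=
  (‖lam‖ / (2 * π * Real.sinh (2 * ‖lam‖ * t))) ^ ((n : ℝ) / 2) *
    Real.exp (-(‖lam‖ / 2) * (Real.cosh (2 * ‖lam‖ * t) / Real.sinh (2 * ‖lam‖ * t)) *
        ‖x' - y'‖ ^ 2 - ‖lam‖ * Real.tanh (‖lam‖ * t) * dotp x' y')

/-- Grushin heat kernel `H_t(x,y) = (2π)^{-m} ∫ k_{t,λ}(x',y') e^{-iλ·(x''-y'')} dλ`. -/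
def grushinH {n m : ℕ} (t : ℝ) (x y : Ep n m) : ℂ :=
  ((((2 * π) ^ m)⁻¹ : ℝ) : ℂ) * ∫ lam : EuclideanSpace ℝ (Fin m),
    ((hermiteK n t lam x.1 y.1 : ℝ) : ℂ) *
      Complex.exp (-Complex.I * ((dotp lam (x.2 - y.2) : ℝ) : ℂ))

/-- Drifted Grushin heat kernel `H_{t,a}(x,y) = e^{-|a|²t} e^{-a·(x'+y')} H_t(x,y)`. -/
def driftH {n m : ℕ} (a : EuclideanSpace ℝ (Fin n)) (t : ℝ) (x y : Ep n m) : ℂ :=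
  ((Real.exp (-‖a‖ ^ 2 * t) * Real.exp (-dotp a (x.1 + y.1)) : ℝ) : ℂ) * grushinH t x y

/-- The drifted heat semigroup `e^{-tG_a} f(x) = ∫ H_{t,a}(x,y) f(y) e^{2a·y'} dy`. -/
def heatOp {n m : ℕ} (a : EuclideanSpace ℝ (Fin n)) (t : ℝ) (f : Ep n m → ℂ)
    (x : Ep n m) : ℂ :=
  ∫ y : Ep n m, driftH a t x y * f y * ((Real.exp (2 * dotp a y.1) : ℝ) : ℂ)

/-- The partial derivative `∂_{x'_i}`. -/
def pdx1 {n m : ℕ} (i : Fin n) (f : Ep n m → ℂ) (x : Ep n m) : ℂ :=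
  deriv (fun s : ℝ => f (x.1 + s • EuclideanSpace.single i 1, x.2)) 0

/-- The scaled Riesz transform `∂^k_{x'_1} (G_a)^{-k/2} f(x)
= Γ(k/2)⁻¹ ∫₀^∞ t^{k/2-1} ∂^k_{x'_1} (e^{-tG_a} f)(x) dt`. -/
def rieszPd1 {n m : ℕ} (a : EuclideanSpace ℝ (Fin n)) (i : Fin n) (k : ℕ)
    (f : Ep n m → ℂ) (x : Ep n m) : ℂ :=
  ((Real.Gamma ((k : ℝ) / 2))⁻¹ : ℝ) *
    ∫ t in Set.Ioi (0 : ℝ),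
      ((t ^ (((k : ℝ) / 2) - 1) : ℝ) : ℂ) * (pdx1 i)^[k] (heatOp a t f) x

/-- The heat semigroup of the Euclidean Laplacian with drift `e₁` on `ℝ^{n+m}`:
`e^{-tΔ_{e₁}} f(x) = (4πt)^{-(n+m)/2} ∫ e^{-t} e^{-x'_1-y'_1} e^{-|x-y|²/(4t)} f(y) e^{2y'_1} dy`. -/
def euclHeat {n m : ℕ} (i : Fin n) (t : ℝ) (f : Ep n m → ℂ) (x : Ep n m) : ℂ :=
  (((4 * π * t) ^ (-(((n : ℝ) + (m : ℝ)) / 2)) : ℝ) : ℂ) *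
    ∫ y : Ep n m,
      ((Real.exp (-t) * Real.exp (-(x.1 i) - y.1 i) *
          Real.exp (-(‖x.1 - y.1‖ ^ 2 + ‖x.2 - y.2‖ ^ 2) / (4 * t)) *
            Real.exp (2 * y.1 i) : ℝ) : ℂ) * f y

/-- The Euclidean Riesz transform with drift `e₁`:
`∂^k_{x'_1} (Δ_{e₁})^{-k/2} f(x) = Γ(k/2)⁻¹ ∫₀^∞ t^{k/2-1} ∂^k_{x'_1} e^{-tΔ_{e₁}} f(x) dt`. -/
def euclRiesz {n m : ℕ} (i : Fin n) (k : ℕ) (f : Ep n m → ℂ) (x : Ep n m) : ℂ :=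
  ((Real.Gamma ((k : ℝ) / 2))⁻¹ : ℝ) *
    ∫ t in Set.Ioi (0 : ℝ),
      ((t ^ (((k : ℝ) / 2) - 1) : ℝ) : ℂ) * (pdx1 i)^[k] (euclHeat i t f) x

/-! ## Scalar functions -/

/-- `sinh u / u`, with value `1` at `0`. -/
def shn (u : ℝ) : ℝ := dslope Real.sinh 0 u

lemma shn_zero : shn 0 = 1 := by simp [shn]

lemma shn_mul (u : ℝ) : u * shn u = Real.sinh u := by
  have := sub_smul_dslope Real.sinh 0 u
  simpa [shn] using this

lemma continuous_shn : Continuous shn := by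
  have h : ContinuousOn (dslope Real.sinh 0) univ :=
    (continuousOn_dslope (by simp)).2 ⟨Real.continuous_sinh.continuousOn,
      Real.differentiable_sinh.differentiableAt⟩
  simpa [shn, continuousOn_univ] using! h

lemma one_le_shn {u : ℝ} (hu : 0 ≤ u) : 1 ≤ shn u := by
  rcases hu.eq_or_lt with rfl | hu
  · simp [shn_zero]
  · have h1 := shn_mul u
    have h2 : u ≤ Real.sinh u := Real.self_le_sinh_iff.2 hu.le
    nlinarith

lemma shn_pos {u : ℝ} (hu : 0 ≤ u) : 0 < shn u := lt_of_lt_of_le one_pos (one_le_shn hu)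

lemma sinh_le_mul_cosh {u : ℝ} (hu : 0 ≤ u) : Real.sinh u ≤ u * Real.cosh u := by
  have hd : ∀ x : ℝ, HasDerivAt (fun x => x * Real.cosh x - Real.sinh x)
      (1 * Real.cosh x + x * Real.sinh x - Real.cosh x) x := fun x =>
    ((hasDerivAt_id x).mul (Real.hasDerivAt_cosh x)).sub (Real.hasDerivAt_sinh x)
  have : MonotoneOn (fun x => x * Real.cosh x - Real.sinh x) (Ici 0) := by
    apply monotoneOn_of_deriv_nonneg (convex_Ici 0)
    · fun_prop
    · fun_prop
    · intro x hx
      rw [(hd x).deriv]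
      simp only [interior_Ici, mem_Ioi] at hx
      have := Real.sinh_pos_iff.2 hx
      have : 0 ≤ x * Real.sinh x := by positivity
      linarith
  have h := this (by simp) (show u ∈ Ici 0 from hu) hu
  simp at h
  linarith

lemma shn_le_cosh {u : ℝ} (hu : 0 ≤ u) : shn u ≤ Real.cosh u := by
  rcases hu.eq_or_lt with rfl | hu
  · simp [shn_zero]
  · have h1 := shn_mul u
    have h2 := sinh_le_mul_cosh hu.le
    rw [← h1] at h2
    exact le_of_mul_le_mul_left h2 hu

/-- `shn w / cosh w ≥ 1/(1+w)`. -/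
lemma cosh_le_shn {w : ℝ} (hw : 0 ≤ w) : Real.cosh w ≤ (1 + w) * shn w := by
  rcases hw.eq_or_lt with rfl | hw
  · simp [shn_zero]
  · have h1 := shn_mul w
    have h2 : Real.cosh w - Real.sinh w = Real.exp (-w) := Real.cosh_sub_sinh w
    have h3 : w * Real.exp (-w) ≤ Real.sinh w := by
      rw [Real.sinh_eq]
      have := Real.add_one_le_exp (2 * w)
      have e : Real.exp w = Real.exp (2 * w) * Real.exp (-w) := by
        rw [← Real.exp_add]; ring_nf
      have := Real.exp_pos (-w)
      rw [e]; nlinarith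
    refine le_of_mul_le_mul_left ?_ hw
    have : w * ((1 + w) * shn w) = (1 + w) * Real.sinh w := by rw [← h1]; ring
    rw [this]
    have : Real.cosh w = Real.sinh w + Real.exp (-w) := by linarith
    rw [this]; nlinarith

/-- `β = r² s tanh(w)/w` with `w = r R s`. -/
def bet (R s r : ℝ) : ℝ := r ^ 2 * s * (shn (r * R * s) / Real.cosh (r * R * s))

/-- Regularised Mehler kernel. -/
def kr (n : ℕ) (R s r q : ℝ) : ℝ :=
  ((4 * π * s)⁻¹ / shn (2 * r * R * s)) ^ ((n : ℝ) / 2) *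
    Real.exp (-((4 * s)⁻¹ * (Real.cosh (2 * r * R * s) / shn (2 * r * R * s)) * q))

/-- Gaussian. -/
def gau (n : ℕ) (s q : ℝ) : ℝ :=
  ((4 * π * s)⁻¹) ^ ((n : ℝ) / 2) * Real.exp (-((4 * s)⁻¹ * q))

lemma bet_mul_R {R s r : ℝ} : bet R s r * R = r * Real.tanh (r * R * s) := by
  rw [Real.tanh_eq_sinh_div_cosh, ← shn_mul, bet]
  ring

lemma bet_zero {s r : ℝ} : bet 0 s r = r ^ 2 * s := by simp [bet, shn_zero]

lemma kr_zero {n : ℕ} {s r q : ℝ} : kr n 0 s r q = gau n s q := by simp [kr, gau, shn_zero]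

lemma bet_nonneg {R s r : ℝ} (hR : 0 ≤ R) (hs : 0 < s) (hr : 0 ≤ r) : 0 ≤ bet R s r := by
  have := shn_pos (show 0 ≤ r * R * s by positivity)
  have := Real.cosh_pos (r * R * s)
  unfold bet; positivity

lemma bet_mul_R_le {R s r : ℝ} (hr : 0 ≤ r) : bet R s r * R ≤ r := by
  rw [bet_mul_R]
  have := (Real.tanh_lt_one (r * R * s)).le
  nlinarith

lemma bet_lower {R s r : ℝ} (hR : 0 ≤ R) (hs : 0 < s) (hr : 0 ≤ r) :
    s / (1 + R * s) * (r - 1) ≤ bet R s r := by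
  rcases le_total r 1 with h | h
  · refine le_trans ?_ (bet_nonneg hR hs hr)
    have : 0 ≤ s / (1 + R * s) := by positivity
    nlinarith
  · have hw : 0 ≤ r * R * s := by positivity
    have hc := Real.cosh_pos (r * R * s)
    have h1 : 1 / (1 + r * R * s) ≤ shn (r * R * s) / Real.cosh (r * R * s) := by
      rw [div_le_div_iff₀ (by positivity) hc]
      have := cosh_le_shn hw
      linarith
    have h2 : 1 / (r * (1 + R * s)) ≤ 1 / (1 + r * R * s) := by
      apply one_div_le_one_div_of_le (by positivity)
      nlinarith
    have hr0 : 0 < r := by linarith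
    calc s / (1 + R * s) * (r - 1) ≤ s / (1 + R * s) * r := by
          have : 0 ≤ s / (1 + R * s) := by positivity
          nlinarith
      _ = r ^ 2 * s * (1 / (r * (1 + R * s))) := by field_simp
      _ ≤ _ := by
          unfold bet
          have := h2.trans h1
          gcongr

lemma kr_nonneg {n : ℕ} {R s r q : ℝ} (hR : 0 ≤ R) (hs : 0 < s) (hr : 0 ≤ r) :
    0 ≤ kr n R s r q := by
  have := shn_pos (show 0 ≤ 2 * r * R * s by positivity)
  unfold kr; positivity

lemma kr_le {n : ℕ} {R s r q : ℝ} (hR : 0 ≤ R) (hs : 0 < s) (hr : 0 ≤ r) (hq : 0 ≤ q) :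
    kr n R s r q ≤ gau n s q := by
  have hu : 0 ≤ 2 * r * R * s := by positivity
  have h0 := shn_pos hu
  have h1 := one_le_shn hu
  have h2 := shn_le_cosh hu
  unfold kr gau
  have h3 : 1 ≤ Real.cosh (2 * r * R * s) / shn (2 * r * R * s) := by
    rwa [le_div_iff₀ h0, one_mul]
  have h4 : (4 * π * s)⁻¹ / shn (2 * r * R * s) ≤ (4 * π * s)⁻¹ :=
    div_le_self (by positivity) h1
  have h5 : (4 * s)⁻¹ ≤ (4 * s)⁻¹ * (Real.cosh (2 * r * R * s) / shn (2 * r * R * s)) :=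
    le_mul_of_one_le_right (by positivity) h3
  gcongr

lemma gau_nonneg {n : ℕ} {s q : ℝ} (hs : 0 < s) : 0 ≤ gau n s q := by
  unfold gau; positivity

lemma measurable_shn : Measurable shn := continuous_shn.measurable

lemma measurable_bet {α : Type*} [MeasurableSpace α] {R : ℝ} {s r : α → ℝ}
    (hs : Measurable s) (hr : Measurable r) : Measurable (fun a => bet R (s a) (r a)) := by
  have := measurable_shn
  unfold bet
  fun_prop

lemma measurable_kr {α : Type*} [MeasurableSpace α] {n : ℕ} {R : ℝ} {s r q : α → ℝ}
    (hs : Measurable s) (hr : Measurable r) (hq : Measurable q) :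
    Measurable (fun a => kr n R (s a) (r a) (q a)) := by
  have := measurable_shn
  unfold kr
  fun_prop

lemma tendsto_bet {s r : ℝ} :
    Tendsto (fun R => bet R s r) (nhdsWithin 0 (Ioi 0)) (nhds (bet 0 s r)) := by
  have : Continuous (fun R => bet R s r) := by
    have := continuous_shn
    unfold bet
    have h : ∀ R, Real.cosh (r * R * s) ≠ 0 := fun R => (Real.cosh_pos _).ne'
    fun_prop (disch := assumption)
  exact this.continuousAt.mono_left nhdsWithin_le_nhds

lemma tendsto_kr {n : ℕ} {s r q : ℝ} (hs : 0 < s) :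
    Tendsto (fun R => kr n R s r q) (nhdsWithin 0 (Ioi 0)) (nhds (kr n 0 s r q)) := by
  have : ContinuousAt (fun R => kr n R s r q) 0 := by
    have := continuous_shn
    have h0 : shn (2 * r * 0 * s) ≠ 0 := by simp [shn_zero]
    unfold kr
    refine ContinuousAt.mul ?_ ?_
    · refine ContinuousAt.rpow_const ?_ (Or.inr (by positivity))
      exact ContinuousAt.div (by fun_prop) (by fun_prop) h0
    · refine Real.continuous_exp.continuousAt.comp ?_
      refine ContinuousAt.neg (ContinuousAt.mul (ContinuousAt.mul (by fun_prop) ?_) (by fun_prop))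
      exact ContinuousAt.div (by fun_prop) (by fun_prop) h0
  exact this.mono_left nhdsWithin_le_nhds

/-- Exponential decay is dominated by polynomial decay. -/
lemma exp_neg_le_pow {c : ℝ} (hc : 0 < c) (N : ℕ) :
    ∃ C : ℝ, 0 ≤ C ∧ ∀ r : ℝ, 0 ≤ r → Real.exp (-(c * r)) ≤ C * ((1 + r) ^ N)⁻¹ := by
  refine ⟨N.factorial * (c⁻¹) ^ N * Real.exp c, by positivity, fun r hr => ?_⟩
  have h1 := Real.pow_div_factorial_le_exp (c * (1 + r)) (by positivity) N
  have h2 : Real.exp (-(c * r)) = Real.exp c * (Real.exp (c * (1 + r)))⁻¹ := by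
    rw [← Real.exp_neg, ← Real.exp_add]; ring_nf
  rw [h2]
  have h3 : (Real.exp (c * (1 + r)))⁻¹ ≤ ((c * (1 + r)) ^ N / N.factorial)⁻¹ := by
    gcongr
  have h4 : ((c * (1 + r)) ^ N / N.factorial)⁻¹ = N.factorial * (c⁻¹) ^ N * ((1 + r) ^ N)⁻¹ := by
    rw [inv_div, mul_pow, inv_pow]; field_simp
  rw [h4] at h3
  calc _ ≤ Real.exp c * (N.factorial * (c⁻¹) ^ N * ((1 + r) ^ N)⁻¹) := by gcongr
    _ = _ := by ring

lemma integrable_inv_pow (m : ℕ) :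
    Integrable (fun μ : EuclideanSpace ℝ (Fin m) => ((1 + ‖μ‖) ^ (m + 1))⁻¹) := by
  have h := integrable_one_add_norm (E := EuclideanSpace ℝ (Fin m)) (μ := volume)
    (r := (m + 1 : ℕ)) (by simp)
  refine h.congr (ae_of_all _ fun μ => ?_)
  simp only
  rw [Real.rpow_neg (by positivity), Real.rpow_natCast]

lemma integrable_exp_bet (m : ℕ) {R s : ℝ} (hR : 0 ≤ R) (hs : 0 < s) :
    Integrable (fun μ : EuclideanSpace ℝ (Fin m) => Real.exp (-(bet R s ‖μ‖ / 2))) := by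
  have hc : 0 < s / (1 + R * s) / 2 := by positivity
  obtain ⟨C, hC, h⟩ := exp_neg_le_pow hc (m + 1)
  refine Integrable.mono' (((integrable_inv_pow m).const_mul C).const_mul
    (Real.exp (s / (1 + R * s) / 2))) ?_ (ae_of_all _ fun μ => ?_)
  · exact (((measurable_bet (s := fun _ => s) measurable_const
      measurable_norm).div_const 2).neg.exp).aestronglyMeasurable
  · have h1 := bet_lower hR hs (norm_nonneg μ)
    rw [Real.norm_of_nonneg (by positivity)]
    refine le_trans ?_ (mul_le_mul_of_nonneg_left (h ‖μ‖ (norm_nonneg μ)) (by positivity))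
    rw [← Real.exp_add]
    gcongr
    linarith

lemma integrable_gau (n : ℕ) {s : ℝ} (hs : 0 < s) :
    Integrable (fun v : EuclideanSpace ℝ (Fin n) => gau n s (‖v‖ ^ 2)) := by
  have hb : 0 < (4 * s)⁻¹ := by positivity
  have h : Integrable (fun v : EuclideanSpace ℝ (Fin n) => Real.exp (-(4 * s)⁻¹ * ‖v‖ ^ 2)) := by
    by_contra hh
    have h1 := integral_undef hh
    rw [GaussianFourier.integral_rexp_neg_mul_sq_norm hb] at h1
    have : 0 < (π / (4 * s)⁻¹) ^ ((Module.finrank ℝ (EuclideanSpace ℝ (Fin n)) : ℝ) / 2) := by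
      positivity
    linarith
  refine (h.const_mul (((4 * π * s)⁻¹) ^ ((n : ℝ) / 2))).congr (ae_of_all _ fun v => ?_)
  simp [gau]

lemma integral_gau (n : ℕ) {s : ℝ} (hs : 0 < s) :
    ∫ v : EuclideanSpace ℝ (Fin n), gau n s (‖v‖ ^ 2) = 1 := by
  have hb : 0 < (4 * s)⁻¹ := by positivity
  have h := GaussianFourier.integral_rexp_neg_mul_sq_norm (V := EuclideanSpace ℝ (Fin n)) hb
  unfold gau
  rw [integral_const_mul]
  simp only [← neg_mul]
  rw [h, finrank_euclideanSpace_fin, ← Real.mul_rpow (by positivity) (by positivity)]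
  have : (4 * π * s)⁻¹ * (π / (4 * s)⁻¹) = 1 := by field_simp
  rw [this, Real.one_rpow]

/-! ## Partial Fourier transform of smooth compactly supported functions -/

/-- Smooth and supported in the ball of radius `ρ`. -/
structure SC {n m : ℕ} (ρ : ℝ) (g : Ep n m → ℂ) : Prop where
  smooth : ContDiff ℝ (⊤ : ℕ∞) g
  supp : ∀ w, ρ < ‖w‖ → g w = 0

lemma SC.continuous {n m : ℕ} {ρ : ℝ} {g : Ep n m → ℂ} (h : SC ρ g) : Continuous g :=
  h.smooth.continuous

lemma exists_bound_of_supp {n m : ℕ} {ρ : ℝ} {F : Type*} [NormedAddCommGroup F] {h : Ep n m → F}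
    (hc : Continuous h) (hs : ∀ w, ρ < ‖w‖ → h w = 0) : ∃ C, 0 ≤ C ∧ ∀ w, ‖h w‖ ≤ C := by
  obtain ⟨C, hC⟩ := (isCompact_closedBall (0 : Ep n m) ρ).exists_bound_of_continuousOn
    hc.continuousOn
  refine ⟨max C 0, le_max_right _ _, fun w => ?_⟩
  by_cases hw : ‖w‖ ≤ ρ
  · exact (hC w (by simpa using hw)).trans (le_max_left _ _)
  · rw [hs w (not_le.1 hw)]; simp

lemma pdx1_hasDerivAt {n m : ℕ} {g : Ep n m → ℂ} (hg : ContDiff ℝ (⊤ : ℕ∞) g) (i : Fin n)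
    (w : EuclideanSpace ℝ (Fin n)) (z : EuclideanSpace ℝ (Fin m)) (τ : ℝ) :
    HasDerivAt (fun σ : ℝ => g (w + σ • EuclideanSpace.single i (1 : ℝ), z))
      (fderiv ℝ g (w + τ • EuclideanSpace.single i (1 : ℝ), z)
        (EuclideanSpace.single i (1 : ℝ), 0)) τ := by
  have h1 : HasFDerivAt g (fderiv ℝ g (w + τ • EuclideanSpace.single i (1 : ℝ), z))
      (w + τ • EuclideanSpace.single i (1 : ℝ), z) :=
    (hg.differentiable (by simp)).differentiableAt.hasFDerivAt
  have h2 : HasDerivAt (fun σ : ℝ => (w + σ • EuclideanSpace.single i (1 : ℝ), z))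
      (EuclideanSpace.single i (1 : ℝ), (0 : EuclideanSpace ℝ (Fin m))) τ := by
    refine HasDerivAt.prodMk ?_ (hasDerivAt_const _ _)
    simpa using ((hasDerivAt_id τ).smul_const (EuclideanSpace.single i (1 : ℝ))).const_add w
  exact h1.comp_hasDerivAt τ h2

lemma pdx1_eq {n m : ℕ} {g : Ep n m → ℂ} (hg : ContDiff ℝ (⊤ : ℕ∞) g) (i : Fin n) :
    pdx1 i g = fun x => fderiv ℝ g x (EuclideanSpace.single i (1 : ℝ), 0) := by
  funext x
  have := (pdx1_hasDerivAt hg i x.1 x.2 0).deriv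
  simpa [pdx1] using this

lemma SC.pdx1 {n m : ℕ} {ρ : ℝ} {g : Ep n m → ℂ} (h : SC ρ g) (i : Fin n) : SC ρ (pdx1 i g) := by
  rw [pdx1_eq h.smooth]
  refine ⟨?_, fun w hw => ?_⟩
  · exact (h.smooth.fderiv_right (m := (⊤ : ℕ∞)) (by simp)).clm_apply contDiff_const
  · have : g =ᶠ[nhds w] fun _ => 0 := by
      filter_upwards [(isOpen_lt continuous_const continuous_norm).mem_nhds hw] with y hy
      exact h.supp y hy
    rw [this.fderiv_eq]; simp

lemma SC.hasDerivAt {n m : ℕ} {ρ : ℝ} {g : Ep n m → ℂ} (h : SC ρ g) (i : Fin n)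
    (w : EuclideanSpace ℝ (Fin n)) (z : EuclideanSpace ℝ (Fin m)) (τ : ℝ) :
    HasDerivAt (fun σ : ℝ => g (w + σ • EuclideanSpace.single i (1 : ℝ), z))
      (_root_.pdx1 i g (w + τ • EuclideanSpace.single i (1 : ℝ), z)) τ := by
  rw [pdx1_eq h.smooth]
  exact pdx1_hasDerivAt h.smooth i w z τ

/-- Partial Fourier transform in the second variable. -/
def PF {n m : ℕ} (g : Ep n m → ℂ) (w : EuclideanSpace ℝ (Fin n)) (μ : EuclideanSpace ℝ (Fin m)) :
    ℂ := ∫ z : EuclideanSpace ℝ (Fin m), Complex.exp (Complex.I * ((dotp μ z : ℝ) : ℂ)) * g (w, z)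

lemma dotp_eq_inner {n : ℕ} (a b : EuclideanSpace ℝ (Fin n)) : dotp a b = inner ℝ a b := by
  simp [dotp, PiLp.inner_apply, mul_comm]

lemma continuous_dotp {n : ℕ} {α : Type*} [TopologicalSpace α] {a b : α → EuclideanSpace ℝ (Fin n)}
    (ha : Continuous a) (hb : Continuous b) : Continuous (fun t => dotp (a t) (b t)) := by
  simp only [dotp_eq_inner]; fun_prop

lemma norm_exp_I_mul (t : ℝ) : ‖Complex.exp (Complex.I * (t : ℂ))‖ = 1 := by
  rw [mul_comm]; exact Complex.norm_exp_ofReal_mul_I t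

lemma PF_supp {n m : ℕ} {ρ : ℝ} {g : Ep n m → ℂ} (h : SC ρ g) {w : EuclideanSpace ℝ (Fin n)}
    (hw : ρ < ‖w‖) (μ : EuclideanSpace ℝ (Fin m)) : PF g w μ = 0 := by
  unfold PF
  have : ∀ z, g (w, z) = 0 := fun z => h.supp _ (hw.trans_le (by simp [Prod.norm_def]))
  simp [this]

lemma SC.bound {n m : ℕ} {ρ : ℝ} {g : Ep n m → ℂ} (h : SC ρ g) :
    ∃ C, 0 ≤ C ∧ ∀ w z, ‖g (w, z)‖ ≤ (Metric.closedBall (0 : EuclideanSpace ℝ (Fin m)) ρ).indicator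
      (fun _ => C) z := by
  obtain ⟨C, hC, hb⟩ := exists_bound_of_supp h.continuous h.supp
  refine ⟨C, hC, fun w z => ?_⟩
  by_cases hz : ‖z‖ ≤ ρ
  · rw [indicator_of_mem (by simpa using hz)]; exact hb _
  · rw [indicator_of_notMem (by simpa using hz), h.supp]; · simp
    exact (not_le.1 hz).trans_le (by simp [Prod.norm_def])

lemma integrable_ind (m : ℕ) (ρ C : ℝ) :
    Integrable ((Metric.closedBall (0 : EuclideanSpace ℝ (Fin m)) ρ).indicator (fun _ => C)) := by
  rw [integrable_indicator_iff Metric.isClosed_closedBall.measurableSet]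
  exact integrableOn_const (isCompact_closedBall _ _).measure_lt_top.ne

lemma PF_continuous {n m : ℕ} {ρ : ℝ} {g : Ep n m → ℂ} (h : SC ρ g) :
    Continuous (fun p : EuclideanSpace ℝ (Fin n) × EuclideanSpace ℝ (Fin m) => PF g p.1 p.2) := by
  obtain ⟨C, hC, hb⟩ := h.bound
  have hg := h.continuous
  unfold PF
  refine continuous_of_dominated (bound :=
    (Metric.closedBall (0 : EuclideanSpace ℝ (Fin m)) ρ).indicator (fun _ => C)) ?_ ?_
    (integrable_ind m ρ C) ?_
  · intro p
    have := continuous_dotp (continuous_const (y := p.2))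
      (continuous_id (X := EuclideanSpace ℝ (Fin m)))
    simp only [id] at this
    exact (by fun_prop : Continuous _).aestronglyMeasurable
  · intro p
    refine ae_of_all _ fun z => ?_
    rw [norm_mul, norm_exp_I_mul, one_mul]; exact hb _ _
  · refine ae_of_all _ fun z => ?_
    have := continuous_dotp (continuous_snd (X := EuclideanSpace ℝ (Fin n))
      (Y := EuclideanSpace ℝ (Fin m))) (continuous_const (y := z))
    fun_prop

lemma PF_hasDerivAt {n m : ℕ} {ρ : ℝ} {g : Ep n m → ℂ} (h : SC ρ g) (i : Fin n)
    (w : EuclideanSpace ℝ (Fin n)) (μ : EuclideanSpace ℝ (Fin m)) (τ : ℝ) :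
    HasDerivAt (fun σ : ℝ => PF g (w + σ • EuclideanSpace.single i (1 : ℝ)) μ)
      (PF (pdx1 i g) (w + τ • EuclideanSpace.single i (1 : ℝ)) μ) τ := by
  obtain ⟨C, hC, hb⟩ := h.bound
  obtain ⟨C', hC', hb'⟩ := (h.pdx1 i).bound
  have hg := h.continuous
  have hg' := (h.pdx1 i).continuous
  have hd := continuous_dotp (continuous_const (y := μ))
      (continuous_id (X := EuclideanSpace ℝ (Fin m)))
  simp only [id] at hd
  unfold PF
  refine (hasDerivAt_integral_of_dominated_loc_of_deriv_le (s := univ) (bound :=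
    (Metric.closedBall (0 : EuclideanSpace ℝ (Fin m)) ρ).indicator (fun _ => C'))
    (F' := fun σ z => Complex.exp (Complex.I * ((dotp μ z : ℝ) : ℂ)) *
      pdx1 i g (w + σ • EuclideanSpace.single i (1 : ℝ), z)) univ_mem ?_ ?_ ?_ ?_
      (integrable_ind m ρ C') ?_).2
  · exact Eventually.of_forall fun σ => (by fun_prop : Continuous _).aestronglyMeasurable
  · refine Integrable.mono' (integrable_ind m ρ C)
      (by fun_prop : Continuous _).aestronglyMeasurable (ae_of_all _ fun z => ?_)
    rw [norm_mul, norm_exp_I_mul, one_mul]; exact hb _ _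
  · exact (by fun_prop : Continuous _).aestronglyMeasurable
  · refine ae_of_all _ fun z σ _ => ?_
    rw [norm_mul, norm_exp_I_mul, one_mul]; exact hb' _ _
  · refine ae_of_all _ fun z σ _ => ?_
    exact (h.hasDerivAt i w z σ).const_mul _

lemma slice_bound {n m : ℕ} {ρ : ℝ} {g : Ep n m → ℂ} (h : SC ρ g) (q : ℕ) :
    ∃ C, 0 ≤ C ∧ ∀ w z, ‖iteratedFDeriv ℝ q (fun z => g (w, z)) z‖ ≤
      (Metric.closedBall (0 : EuclideanSpace ℝ (Fin m)) ρ).indicator (fun _ => C) z := by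
  have hc : Continuous (iteratedFDeriv ℝ q g) :=
    h.smooth.continuous_iteratedFDeriv (by exact_mod_cast le_top)
  have hs : ∀ w, ρ < ‖w‖ → iteratedFDeriv ℝ q g w = 0 := by
    intro w hw
    have : g =ᶠ[nhds w] fun _ => 0 := by
      filter_upwards [(isOpen_lt continuous_const continuous_norm).mem_nhds hw] with y hy
      exact h.supp y hy
    rw [(this.iteratedFDeriv ℝ q).eq_of_nhds]
    have := iteratedFDeriv_fun_zero (𝕜 := ℝ) (E := Ep n m) (F := ℂ) (n := q)
    exact congrFun this w
  obtain ⟨C, hC, hb⟩ := exists_bound_of_supp hc hs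
  refine ⟨C, hC, fun w z => ?_⟩
  have key : ‖iteratedFDeriv ℝ q (fun z => g (w, z)) z‖ ≤ ‖iteratedFDeriv ℝ q g (w, z)‖ := by
    have e : (fun z => g (w, z)) = (fun y => g ((w, 0) + y)) ∘
        (ContinuousLinearMap.inr ℝ (EuclideanSpace ℝ (Fin n)) (EuclideanSpace ℝ (Fin m))) := by
      funext z; simp
    have hG : ContDiff ℝ (⊤ : ℕ∞) (fun y : Ep n m => g ((w, 0) + y)) :=
      h.smooth.comp (contDiff_const.add contDiff_id)
    rw [e, ContinuousLinearMap.iteratedFDeriv_comp_right _ hG _ (by exact_mod_cast le_top)]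
    refine (ContinuousMultilinearMap.norm_compContinuousLinearMap_le _ _).trans ?_
    rw [iteratedFDeriv_comp_add_left']
    simp only [ContinuousLinearMap.inr_apply, Prod.mk_add_mk, add_zero, zero_add]
    refine mul_le_of_le_one_right (norm_nonneg _) ?_
    refine Finset.prod_le_one (fun _ _ => norm_nonneg _) fun _ _ => ?_
    exact ContinuousLinearMap.norm_inr_le_one ..
  refine key.trans ?_
  by_cases hz : ‖z‖ ≤ ρ
  · rw [indicator_of_mem (by simpa using hz)]; exact hb _
  · rw [indicator_of_notMem (by simpa using hz), hs]; · simp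
    exact (not_le.1 hz).trans_le (by simp [Prod.norm_def])

open FourierTransform in
lemma PF_eq_fourier {n m : ℕ} (g : Ep n m → ℂ) (w : EuclideanSpace ℝ (Fin n))
    (μ : EuclideanSpace ℝ (Fin m)) :
    PF g w μ = 𝓕 (fun z => g (w, z)) (-(2 * π)⁻¹ • μ) := by
  rw [Real.fourier_eq']
  unfold PF
  congr 1
  funext z
  rw [smul_eq_mul, dotp_eq_inner, inner_smul_right, real_inner_comm]
  congr 2
  have : -2 * π * (-(2 * π)⁻¹ * inner ℝ μ z) = inner ℝ μ z := by field_simp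
  rw [real_inner_comm μ z, real_inner_comm z μ] at *
  rw [this]; ring

open FourierTransform in
lemma PF_pow {n m : ℕ} {ρ : ℝ} {g : Ep n m → ℂ} (h : SC ρ g) (N : ℕ) :
    ∃ C, 0 ≤ C ∧ ∀ w μ, ‖μ‖ ^ N * ‖PF g w μ‖ ≤ C := by
  choose C hC hb using slice_bound h
  let D : ℝ := ∑ p ∈ Finset.range (0 + 1) ×ˢ Finset.range (N + 1),
    ∫ z, (Metric.closedBall (0 : EuclideanSpace ℝ (Fin m)) ρ).indicator (fun _ => C p.2) z
  refine ⟨(2 * π) ^ N * (2 ^ N * D), ?_, fun w μ => ?_⟩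
  · have : 0 ≤ D := Finset.sum_nonneg fun p _ => integral_nonneg fun z =>
      indicator_nonneg (fun _ _ => hC _) _
    positivity
  have hsm : ContDiff ℝ (N : ℕ∞) (fun z => g (w, z)) :=
    (h.smooth.comp (contDiff_const.prodMk contDiff_id)).of_le (by exact_mod_cast le_top)
  have hsm' : ContDiff ℝ (⊤ : ℕ∞) (fun z => g (w, z)) :=
    (h.smooth.comp (contDiff_const.prodMk contDiff_id))
  have hInt : ∀ k q : ℕ, (k : ℕ∞) ≤ (0 : ℕ∞) → (q : ℕ∞) ≤ (N : ℕ∞) → Integrable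
      (fun v ↦ ‖v‖ ^ k * ‖iteratedFDeriv ℝ q (fun z => g (w, z)) v‖) := by
    intro k q hk _
    have hk : k = 0 := by simpa using hk
    subst hk
    have hcc := hsm'.continuous_iteratedFDeriv (m := q) (by exact_mod_cast le_top)
    refine Integrable.mono' (integrable_ind m ρ (C q))
      (by fun_prop : Continuous _).aestronglyMeasurable (ae_of_all _ fun z => ?_)
    simpa using hb q w z
  have key := Real.pow_mul_norm_iteratedFDeriv_fourier_le (K := 0) (N := N) hsm hInt (k := 0)
    (n := N) (by simp) (by simp) (-(2 * π)⁻¹ • μ)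
  rw [norm_iteratedFDeriv_zero, ← PF_eq_fourier, norm_smul, mul_pow] at key
  have hpi : ‖-(2 * π)⁻¹‖ = (2 * π)⁻¹ := by
    rw [norm_neg, Real.norm_of_nonneg (by positivity)]
  rw [hpi] at key
  have h2 : ‖μ‖ ^ N * ‖PF g w μ‖ = (2 * π) ^ N * ((2 * π)⁻¹ ^ N * ‖μ‖ ^ N * ‖PF g w μ‖) := by
    rw [inv_pow]; field_simp
  rw [h2]
  refine mul_le_mul_of_nonneg_left (key.trans ?_) (by positivity)
  have e : (2 * π) ^ 0 * (2 * ((0 : ℕ) : ℝ) + 2) ^ N = 2 ^ N := by simp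
  rw [e]
  refine mul_le_mul_of_nonneg_left ?_ (by positivity)
  refine Finset.sum_le_sum fun p hp => ?_
  have hp1 : p.1 = 0 := by
    have := (Finset.mem_product.1 hp).1
    simpa using this
  rw [hp1]
  refine integral_mono_of_nonneg (ae_of_all _ fun z => by positivity) (integrable_ind m ρ _)
    (ae_of_all _ fun z => ?_)
  simpa using hb p.2 w z

lemma PF_decay {n m : ℕ} {ρ : ℝ} {g : Ep n m → ℂ} (h : SC ρ g) (N : ℕ) :
    ∃ C, 0 ≤ C ∧ ∀ w μ, ‖PF g w μ‖ ≤ C * ((1 + ‖μ‖) ^ N)⁻¹ := by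
  obtain ⟨C₀, h0, hb0⟩ := PF_pow h 0
  obtain ⟨C₁, h1, hb1⟩ := PF_pow h N
  refine ⟨2 ^ (N - 1) * (C₀ + C₁), by positivity, fun w μ => ?_⟩
  have hp : 0 < (1 + ‖μ‖) ^ N := by positivity
  rw [← div_eq_mul_inv, le_div_iff₀ hp, mul_comm]
  have h3 := add_pow_le (zero_le_one (α := ℝ)) (norm_nonneg μ) N
  rw [one_pow] at h3
  have h4 := hb0 w μ
  have h5 := hb1 w μ
  rw [pow_zero, one_mul] at h4
  calc (1 + ‖μ‖) ^ N * ‖PF g w μ‖ ≤ 2 ^ (N - 1) * (1 + ‖μ‖ ^ N) * ‖PF g w μ‖ := by gcongr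
    _ = 2 ^ (N - 1) * (‖PF g w μ‖ + ‖μ‖ ^ N * ‖PF g w μ‖) := by ring
    _ ≤ _ := by gcongr

/-! ## The basic oscillatory integrals -/

/-- The point `x' + σ e`. -/
def pt {n m : ℕ} (x : Ep n m) (i : Fin n) (σ : ℝ) : EuclideanSpace ℝ (Fin n) :=
  x.1 + σ • EuclideanSpace.single i (1 : ℝ)

/-- The quadratic form in the exponent. -/
def qq {n m : ℕ} (x : Ep n m) (ξ : EuclideanSpace ℝ (Fin n)) (i : Fin n) (R σ : ℝ)
    (v : EuclideanSpace ℝ (Fin n)) : ℝ :=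
  inner ℝ (R • pt x i σ + ξ) (R • (pt x i σ + v) + ξ)

/-- Its derivative, divided by `R`. -/
def ql {n m : ℕ} (x : Ep n m) (ξ : EuclideanSpace ℝ (Fin n)) (i : Fin n) (R σ : ℝ)
    (v : EuclideanSpace ℝ (Fin n)) : ℝ :=
  inner ℝ (R • pt x i σ + ξ) (EuclideanSpace.single i (1 : ℝ)) +
    inner ℝ (EuclideanSpace.single i (1 : ℝ)) (R • (pt x i σ + v) + ξ)

lemma pt_hasDerivAt {n m : ℕ} (x : Ep n m) (i : Fin n) (σ : ℝ) :
    HasDerivAt (pt x i) (EuclideanSpace.single i (1 : ℝ)) σ := by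
  unfold pt
  simpa using ((hasDerivAt_id σ).smul_const (EuclideanSpace.single i (1 : ℝ))).const_add x.1

lemma norm_pt {n m : ℕ} (x : Ep n m) (i : Fin n) {σ ρ : ℝ} (hρ : ‖x.1‖ + 1 ≤ ρ) (hσ : |σ| ≤ 1) :
    ‖pt x i σ‖ ≤ ρ := by
  unfold pt
  refine (norm_add_le _ _).trans ?_
  rw [norm_smul]
  simp
  linarith

lemma qq_hasDerivAt {n m : ℕ} (x : Ep n m) (ξ : EuclideanSpace ℝ (Fin n)) (i : Fin n) (R σ : ℝ)
    (v : EuclideanSpace ℝ (Fin n)) :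
    HasDerivAt (fun σ => qq x ξ i R σ v) (R * ql x ξ i R σ v) σ := by
  have h := pt_hasDerivAt x i σ
  have h1 := (h.const_smul R).add_const ξ
  have h2 := ((h.add_const v).const_smul R).add_const ξ
  have := HasDerivAt.inner ℝ h1 h2
  unfold qq ql
  refine this.congr_deriv ?_
  simp only [inner_smul_left, inner_smul_right, Pi.smul_apply, conj_trivial]
  ring

lemma ql_hasDerivAt {n m : ℕ} (x : Ep n m) (ξ : EuclideanSpace ℝ (Fin n)) (i : Fin n) (R σ : ℝ)
    (v : EuclideanSpace ℝ (Fin n)) :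
    HasDerivAt (fun σ => ql x ξ i R σ v) (2 * R) σ := by
  have h := pt_hasDerivAt x i σ
  have h1 := (h.const_smul R).add_const ξ
  have h2 := ((h.add_const v).const_smul R).add_const ξ
  have h3 := HasDerivAt.inner ℝ h1 (hasDerivAt_const σ (EuclideanSpace.single i (1 : ℝ)))
  have h4 := HasDerivAt.inner ℝ (hasDerivAt_const σ (EuclideanSpace.single i (1 : ℝ))) h2
  unfold ql
  refine (h3.add h4).congr_deriv ?_
  simp [inner_smul_left, inner_smul_right]
  ring

lemma qq_lower {n m : ℕ} (x : Ep n m) {ξ : EuclideanSpace ℝ (Fin n)} (hξ : ‖ξ‖ = 1) (i : Fin n)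
    {R σ ρ : ℝ} (hR : 0 ≤ R) (hRρ : R * ρ ≤ 1 / 5) (hρ : ‖x.1‖ + 1 ≤ ρ) (hσ : |σ| ≤ 1)
    {v : EuclideanSpace ℝ (Fin n)} (hv : ‖pt x i σ + v‖ ≤ ρ) : 1 / 2 ≤ qq x ξ i R σ v := by
  have h1 := norm_pt x i hρ hσ
  unfold qq
  generalize pt x i σ + v = b at *
  generalize pt x i σ = a at *
  rw [inner_add_left, inner_add_right, inner_add_right, inner_smul_left, inner_smul_left,
    inner_smul_right, inner_smul_right, real_inner_self_eq_norm_sq, hξ]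
  simp only [conj_trivial]
  have e1 := (abs_le.1 (abs_real_inner_le_norm a b)).1
  have e2 := (abs_le.1 (abs_real_inner_le_norm a ξ)).1
  have e3 := (abs_le.1 (abs_real_inner_le_norm ξ b)).1
  rw [hξ] at e2 e3
  have f1 : -(ρ * ρ) ≤ inner ℝ a b := by
    have : ‖a‖ * ‖b‖ ≤ ρ * ρ := by
      have := norm_nonneg a
      have := norm_nonneg b
      have : 0 ≤ ρ := by linarith
      gcongr
    linarith
  have f2 : -ρ ≤ inner ℝ a ξ := by linarith
  have f3 : -ρ ≤ inner ℝ ξ b := by linarith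
  have g1 : R * (R * -(ρ * ρ)) ≤ R * (R * inner ℝ a b) := by gcongr
  have g2 : R * -ρ ≤ R * inner ℝ a ξ := by gcongr
  have g3 : R * -ρ ≤ R * inner ℝ ξ b := by gcongr
  have hρ0 : 0 ≤ R * ρ := mul_nonneg hR (by linarith [norm_nonneg a])
  nlinarith

lemma ql_bound {n m : ℕ} (x : Ep n m) {ξ : EuclideanSpace ℝ (Fin n)} (hξ : ‖ξ‖ = 1) (i : Fin n)
    {R σ ρ : ℝ} (hR : 0 ≤ R) (hRρ : R * ρ ≤ 1 / 5) (hρ : ‖x.1‖ + 1 ≤ ρ) (hσ : |σ| ≤ 1)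
    {v : EuclideanSpace ℝ (Fin n)} (hv : ‖pt x i σ + v‖ ≤ ρ) : |ql x ξ i R σ v| ≤ 3 := by
  have h1 := norm_pt x i hρ hσ
  have key : ∀ a : EuclideanSpace ℝ (Fin n), ‖a‖ ≤ ρ → ‖R • a + ξ‖ ≤ 3 / 2 := by
    intro a ha
    refine (norm_add_le _ _).trans ?_
    rw [norm_smul, hξ, Real.norm_of_nonneg hR]
    have : R * ‖a‖ ≤ R * ρ := by gcongr
    linarith
  have he : ‖(EuclideanSpace.single i (1 : ℝ) : EuclideanSpace ℝ (Fin n))‖ = 1 := by simp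
  unfold ql
  refine (abs_add_le _ _).trans ?_
  have e1 := abs_real_inner_le_norm (R • pt x i σ + ξ)
    (EuclideanSpace.single i (1 : ℝ) : EuclideanSpace ℝ (Fin n))
  have e2 := abs_real_inner_le_norm
    (EuclideanSpace.single i (1 : ℝ) : EuclideanSpace ℝ (Fin n)) (R • (pt x i σ + v) + ξ)
  rw [he] at e1 e2
  have := key _ h1
  have := key _ hv
  linarith

/-- The integrand. -/
def ZZ {n m : ℕ} (x : Ep n m) (ξ : EuclideanSpace ℝ (Fin n)) (i : Fin n) (a b : ℕ)
    (g : Ep n m → ℂ) (R s σ : ℝ)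
    (p : EuclideanSpace ℝ (Fin m) × EuclideanSpace ℝ (Fin n)) : ℂ :=
  ((kr n R s ‖p.1‖ (‖p.2‖ ^ 2) * Real.exp (p.2 i) : ℝ) : ℂ) *
    Complex.exp (-Complex.I * ((dotp p.1 x.2 : ℝ) : ℂ)) *
    (((bet R s ‖p.1‖ * R * ql x ξ i R σ p.2) ^ a * (bet R s ‖p.1‖ * R * (2 * R)) ^ b *
      Real.exp (-(bet R s ‖p.1‖ * qq x ξ i R σ p.2)) : ℝ) : ℂ) *
    PF g (pt x i σ + p.2) p.1

lemma norm_exp_neg_I_mul (t : ℝ) : ‖Complex.exp (-Complex.I * (t : ℂ))‖ = 1 := by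
  have := norm_exp_I_mul (-t)
  rw [← this]; push_cast; ring_nf

lemma ZZ_bound {n m : ℕ} (x : Ep n m) {ξ : EuclideanSpace ℝ (Fin n)} (hξ : ‖ξ‖ = 1) (i : Fin n)
    (a b : ℕ) {g : Ep n m → ℂ} {ρ : ℝ} (hg : SC ρ g) (hρ : ‖x.1‖ + 1 ≤ ρ) :
    ∃ C, 0 ≤ C ∧ ∀ R s σ p, 0 ≤ R → R * ρ ≤ 1 / 5 → 0 < s → |σ| ≤ 1 →
      ‖ZZ x ξ i a b g R s σ p‖ ≤ C * (((1 + ‖p.1‖) ^ (m + 1))⁻¹ * gau n s (‖p.2‖ ^ 2)) := by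
  obtain ⟨C, hC, hb⟩ := PF_decay hg (a + b + (m + 1))
  refine ⟨Real.exp (2 * ρ) * 3 ^ a * 2 ^ b * C, by positivity, fun R s σ p hR hRρ hs hσ => ?_⟩
  have hgau := gau_nonneg (n := n) (q := ‖p.2‖ ^ 2) hs
  by_cases hv : ‖pt x i σ + p.2‖ ≤ ρ
  swap
  · rw [ZZ, PF_supp hg (not_le.1 hv)]
    simp only [mul_zero, norm_zero]; positivity
  have hρ0 : 1 ≤ ρ := by linarith [norm_nonneg x.1]
  have hR1 : R ≤ 1 := by nlinarith
  have h1 := qq_lower x hξ i hR hRρ hρ hσ hv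
  have h2 := ql_bound x hξ i hR hRρ hρ hσ hv
  have h3 := bet_nonneg hR hs (norm_nonneg p.1)
  have h4 := bet_mul_R_le (R := R) (s := s) (norm_nonneg p.1)
  have h4' : 0 ≤ bet R s ‖p.1‖ * R := by positivity
  have h5 : p.2 i ≤ 2 * ρ := by
    have e1 : |p.2 i| ≤ ‖p.2‖ := by simpa using PiLp.norm_apply_le p.2 i
    have e2 : ‖p.2‖ ≤ ‖pt x i σ + p.2‖ + ‖pt x i σ‖ := by
      have := norm_sub_le (pt x i σ + p.2) (pt x i σ)
      simpa using this
    have := norm_pt x i hρ hσ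
    linarith [le_abs_self (p.2 i)]
  have k0 := kr_nonneg (n := n) (q := ‖p.2‖ ^ 2) hR hs (norm_nonneg p.1)
  have k1 := kr_le (n := n) (q := ‖p.2‖ ^ 2) hR hs (norm_nonneg p.1) (by positivity)
  set r := ‖p.1‖ with hr
  have hr0 : 0 ≤ r := norm_nonneg _
  have hX : |(bet R s r * R * ql x ξ i R σ p.2)| ≤ 3 * (1 + r) := by
    rw [abs_mul, abs_of_nonneg h4']
    have := abs_nonneg (ql x ξ i R σ p.2)
    nlinarith
  have hY : |bet R s r * R * (2 * R)| ≤ 2 * (1 + r) := by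
    rw [abs_of_nonneg (by positivity)]; nlinarith
  have hE : Real.exp (-(bet R s r * qq x ξ i R σ p.2)) ≤ 1 := by
    rw [Real.exp_le_one_iff]
    have : 0 ≤ bet R s r * qq x ξ i R σ p.2 := mul_nonneg h3 (by linarith)
    linarith
  have hP := hb (pt x i σ + p.2) p.1
  rw [ZZ, norm_mul, norm_mul, norm_mul, norm_exp_neg_I_mul, Complex.norm_real, Complex.norm_real,
    mul_one, Real.norm_eq_abs, Real.norm_eq_abs, abs_mul, abs_mul, abs_mul, abs_pow, abs_pow,
    abs_of_nonneg k0, abs_of_pos (Real.exp_pos _), abs_of_pos (Real.exp_pos _)]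
  calc _ ≤ gau n s (‖p.2‖ ^ 2) * Real.exp (2 * ρ) *
        ((3 * (1 + r)) ^ a * (2 * (1 + r)) ^ b * 1) * (C * ((1 + r) ^ (a + b + (m + 1)))⁻¹) := by
        gcongr
    _ = _ := by
        rw [pow_add, pow_add (1 + r) a b, mul_pow, mul_pow]
        field_simp

lemma ZZ_meas {n m : ℕ} (x : Ep n m) (ξ : EuclideanSpace ℝ (Fin n)) (i : Fin n)
    (a b : ℕ) {g : Ep n m → ℂ} {ρ : ℝ} (hg : SC ρ g) (R σ : ℝ) :
    Measurable (fun t : ℝ × (EuclideanSpace ℝ (Fin m) × EuclideanSpace ℝ (Fin n)) =>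
      ZZ x ξ i a b g R t.1 σ t.2) := by
  have hPF : Measurable (fun t : ℝ × (EuclideanSpace ℝ (Fin m) × EuclideanSpace ℝ (Fin n)) =>
      PF g (pt x i σ + t.2.2) t.2.1) :=
    ((PF_continuous hg).comp (f := fun t : ℝ × (EuclideanSpace ℝ (Fin m) ×
      EuclideanSpace ℝ (Fin n)) => (pt x i σ + t.2.2, t.2.1)) (by fun_prop)).measurable
  have hk := measurable_kr (α := ℝ × (EuclideanSpace ℝ (Fin m) × EuclideanSpace ℝ (Fin n)))
    (n := n) (R := R) (s := fun t => t.1) (r := fun t => ‖t.2.1‖) (q := fun t => ‖t.2.2‖ ^ 2)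
    (by fun_prop) (by fun_prop) (by fun_prop)
  have hbt := measurable_bet (α := ℝ × (EuclideanSpace ℝ (Fin m) × EuclideanSpace ℝ (Fin n)))
    (R := R) (s := fun t => t.1) (r := fun t => ‖t.2.1‖) (by fun_prop) (by fun_prop)
  have hd : Measurable (fun t : ℝ × (EuclideanSpace ℝ (Fin m) × EuclideanSpace ℝ (Fin n)) =>
      dotp t.2.1 x.2) := (continuous_dotp (by fun_prop) (by fun_prop)).measurable
  have hq : Measurable (fun t : ℝ × (EuclideanSpace ℝ (Fin m) × EuclideanSpace ℝ (Fin n)) =>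
      qq x ξ i R σ t.2.2) := by unfold qq; fun_prop
  have hl : Measurable (fun t : ℝ × (EuclideanSpace ℝ (Fin m) × EuclideanSpace ℝ (Fin n)) =>
      ql x ξ i R σ t.2.2) := by unfold ql; fun_prop
  have hi : Measurable (fun t : ℝ × (EuclideanSpace ℝ (Fin m) × EuclideanSpace ℝ (Fin n)) =>
      t.2.2 i) := by fun_prop
  unfold ZZ
  fun_prop

lemma ZZ_meas' {n m : ℕ} (x : Ep n m) (ξ : EuclideanSpace ℝ (Fin n)) (i : Fin n)
    (a b : ℕ) {g : Ep n m → ℂ} {ρ : ℝ} (hg : SC ρ g) (R s σ : ℝ) :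
    Measurable (ZZ x ξ i a b g R s σ) :=
  Measurable.comp (g := fun t : ℝ × (EuclideanSpace ℝ (Fin m) × EuclideanSpace ℝ (Fin n)) =>
      ZZ x ξ i a b g R t.1 σ t.2)
    (f := fun p : EuclideanSpace ℝ (Fin m) × EuclideanSpace ℝ (Fin n) => (s, p))
    (ZZ_meas x ξ i a b hg R σ) measurable_prodMk_left

lemma ZZ_hasDerivAt {n m : ℕ} (x : Ep n m) (ξ : EuclideanSpace ℝ (Fin n)) (i : Fin n)
    (a b : ℕ) {g : Ep n m → ℂ} {ρ : ℝ} (hg : SC ρ g) (R s σ : ℝ)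
    (p : EuclideanSpace ℝ (Fin m) × EuclideanSpace ℝ (Fin n)) :
    HasDerivAt (fun σ => ZZ x ξ i a b g R s σ p)
      (a * ZZ x ξ i (a - 1) (b + 1) g R s σ p - ZZ x ξ i (a + 1) b g R s σ p
        + ZZ x ξ i a b (pdx1 i g) R s σ p) σ := by
  have h1 := ((ql_hasDerivAt x ξ i R σ p.2).const_mul (bet R s ‖p.1‖ * R)).pow a
  have h2 := (((qq_hasDerivAt x ξ i R σ p.2).const_mul (bet R s ‖p.1‖)).neg).exp
  have h3 := ((h1.mul_const ((bet R s ‖p.1‖ * R * (2 * R)) ^ b)).mul h2).ofReal_comp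
  have h4 : HasDerivAt (fun σ => PF g (pt x i σ + p.2) p.1)
      (PF (pdx1 i g) (pt x i σ + p.2) p.1) σ := by
    have := PF_hasDerivAt hg i (x.1 + p.2) p.1 σ
    have e : ∀ σ : ℝ, x.1 + p.2 + σ • EuclideanSpace.single i (1 : ℝ) = pt x i σ + p.2 := by
      intro σ; unfold pt; abel
    simpa only [e] using this
  have h5 := (h3.mul h4).const_mul (((kr n R s ‖p.1‖ (‖p.2‖ ^ 2) * Real.exp (p.2 i) : ℝ) : ℂ) *
    Complex.exp (-Complex.I * ((dotp p.1 x.2 : ℝ) : ℂ)))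
  refine (h5.congr_of_eventuallyEq (Eventually.of_forall fun σ => ?_)).congr_deriv ?_
  · simp only [ZZ, Pi.mul_apply, Pi.pow_apply, Pi.neg_apply]
    push_cast
    ring
  · simp only [ZZ, Pi.mul_apply, Pi.pow_apply, Pi.neg_apply]
    push_cast
    ring

/-- The basic integral. -/
def II {n m : ℕ} (x : Ep n m) (ξ : EuclideanSpace ℝ (Fin n)) (i : Fin n) (a b : ℕ)
    (g : Ep n m → ℂ) (R s σ : ℝ) : ℂ := ∫ p, ZZ x ξ i a b g R s σ p

/-- The iterated derivatives of the basic integral. -/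
def JJ {n m : ℕ} (x : Ep n m) (ξ : EuclideanSpace ℝ (Fin n)) (i : Fin n) : (k : ℕ) → (a b : ℕ) →
    (g : Ep n m → ℂ) → (R s σ : ℝ) → ℂ
  | 0, a, b, g, R, s, σ => II x ξ i a b g R s σ
  | k + 1, a, b, g, R, s, σ => a * JJ x ξ i k (a - 1) (b + 1) g R s σ
      - JJ x ξ i k (a + 1) b g R s σ + JJ x ξ i k a b (pdx1 i g) R s σ

lemma integrable_dom (n m : ℕ) {s : ℝ} (hs : 0 < s) :
    Integrable (fun p : EuclideanSpace ℝ (Fin m) × EuclideanSpace ℝ (Fin n) =>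
      ((1 + ‖p.1‖) ^ (m + 1))⁻¹ * gau n s (‖p.2‖ ^ 2)) :=
  (integrable_inv_pow m).mul_prod (integrable_gau n hs)

lemma integral_dom (n m : ℕ) {s : ℝ} (hs : 0 < s) :
    ∫ p : EuclideanSpace ℝ (Fin m) × EuclideanSpace ℝ (Fin n),
      ((1 + ‖p.1‖) ^ (m + 1))⁻¹ * gau n s (‖p.2‖ ^ 2) =
    ∫ μ : EuclideanSpace ℝ (Fin m), ((1 + ‖μ‖) ^ (m + 1))⁻¹ := by
  have := integral_prod_mul (μ := volume) (ν := volume)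
    (fun μ : EuclideanSpace ℝ (Fin m) => ((1 + ‖μ‖) ^ (m + 1))⁻¹)
    (fun v : EuclideanSpace ℝ (Fin n) => gau n s (‖v‖ ^ 2))
  rw [integral_gau n hs, mul_one] at this
  exact this

lemma ZZ_integrable {n m : ℕ} (x : Ep n m) {ξ : EuclideanSpace ℝ (Fin n)} (hξ : ‖ξ‖ = 1)
    (i : Fin n) (a b : ℕ) {g : Ep n m → ℂ} {ρ : ℝ} (hg : SC ρ g) (hρ : ‖x.1‖ + 1 ≤ ρ)
    {R s σ : ℝ} (hR : 0 ≤ R) (hRρ : R * ρ ≤ 1 / 5) (hs : 0 < s) (hσ : |σ| ≤ 1) :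
    Integrable (ZZ x ξ i a b g R s σ) := by
  obtain ⟨C, hC, hb⟩ := ZZ_bound x hξ i a b hg hρ
  exact Integrable.mono' ((integrable_dom n m hs).const_mul C)
    (ZZ_meas' x ξ i a b hg R s σ).aestronglyMeasurable
    (ae_of_all _ fun p => hb R s σ p hR hRρ hs hσ)

lemma II_bound {n m : ℕ} (x : Ep n m) {ξ : EuclideanSpace ℝ (Fin n)} (hξ : ‖ξ‖ = 1) (i : Fin n)
    (a b : ℕ) {g : Ep n m → ℂ} {ρ : ℝ} (hg : SC ρ g) (hρ : ‖x.1‖ + 1 ≤ ρ) :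
    ∃ C, 0 ≤ C ∧ ∀ R s σ, 0 ≤ R → R * ρ ≤ 1 / 5 → 0 < s → |σ| ≤ 1 →
      ‖II x ξ i a b g R s σ‖ ≤ C := by
  obtain ⟨C, hC, hb⟩ := ZZ_bound x hξ i a b hg hρ
  refine ⟨C * ∫ μ : EuclideanSpace ℝ (Fin m), ((1 + ‖μ‖) ^ (m + 1))⁻¹,
    mul_nonneg hC (integral_nonneg fun μ => by positivity), fun R s σ hR hRρ hs hσ => ?_⟩
  rw [← integral_dom n m hs, ← integral_const_mul]
  exact norm_integral_le_of_norm_le ((integrable_dom n m hs).const_mul C)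
    (ae_of_all _ fun p => hb R s σ p hR hRρ hs hσ)

lemma II_hasDerivAt {n m : ℕ} (x : Ep n m) {ξ : EuclideanSpace ℝ (Fin n)} (hξ : ‖ξ‖ = 1)
    (i : Fin n) (a b : ℕ) {g : Ep n m → ℂ} {ρ : ℝ} (hg : SC ρ g) (hρ : ‖x.1‖ + 1 ≤ ρ)
    {R s σ : ℝ} (hR : 0 ≤ R) (hRρ : R * ρ ≤ 1 / 5) (hs : 0 < s) (hσ : |σ| < 1) :
    HasDerivAt (fun σ => II x ξ i a b g R s σ) (a * II x ξ i (a - 1) (b + 1) g R s σ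
        - II x ξ i (a + 1) b g R s σ + II x ξ i a b (pdx1 i g) R s σ) σ := by
  obtain ⟨C1, hC1, hb1⟩ := ZZ_bound x hξ i (a - 1) (b + 1) hg hρ
  obtain ⟨C2, hC2, hb2⟩ := ZZ_bound x hξ i (a + 1) b hg hρ
  obtain ⟨C3, hC3, hb3⟩ := ZZ_bound x hξ i a b (hg.pdx1 i) hρ
  have hnh : {τ : ℝ | |τ| < 1} ∈ nhds σ := (isOpen_lt continuous_abs continuous_const).mem_nhds hσ
  have i1 := ZZ_integrable x hξ i (a - 1) (b + 1) hg hρ hR hRρ hs hσ.le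
  have i2 := ZZ_integrable x hξ i (a + 1) b hg hρ hR hRρ hs hσ.le
  have i3 := ZZ_integrable x hξ i a b (hg.pdx1 i) hρ hR hRρ hs hσ.le
  have key := (hasDerivAt_integral_of_dominated_loc_of_deriv_le (μ := volume)
    (F := fun σ p => ZZ x ξ i a b g R s σ p)
    (F' := fun σ p => a * ZZ x ξ i (a - 1) (b + 1) g R s σ p - ZZ x ξ i (a + 1) b g R s σ p
        + ZZ x ξ i a b (pdx1 i g) R s σ p) (bound := fun p => (a * C1 + C2 + C3) *
          (((1 + ‖p.1‖) ^ (m + 1))⁻¹ * gau n s (‖p.2‖ ^ 2))) hnh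
    (Eventually.of_forall fun τ => (ZZ_meas' x ξ i a b hg R s τ).aestronglyMeasurable)
    (ZZ_integrable x hξ i a b hg hρ hR hRρ hs hσ.le)
    (((i1.const_mul _).sub i2).add i3).aestronglyMeasurable
    (ae_of_all _ fun p τ hτ => ?_) ((integrable_dom n m hs).const_mul _)
    (ae_of_all _ fun p τ hτ => ZZ_hasDerivAt x ξ i a b hg R s τ p)).2
  · unfold II
    refine key.congr_deriv ?_
    have j1 := i1.const_mul (a : ℂ)
    have j2 : Integrable (fun p => (a : ℂ) * ZZ x ξ i (a - 1) (b + 1) g R s σ p -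
      ZZ x ξ i (a + 1) b g R s σ p) := j1.sub i2
    rw [integral_add j2 i3, integral_sub j1 i2, integral_const_mul]
  · have hτ' : |τ| ≤ 1 := le_of_lt hτ
    have e1 := hb1 R s τ p hR hRρ hs hτ'
    have e2 := hb2 R s τ p hR hRρ hs hτ'
    have e3 := hb3 R s τ p hR hRρ hs hτ'
    refine (norm_add_le _ _).trans ?_
    refine (add_le_add (norm_sub_le _ _) e3).trans ?_
    rw [norm_mul, Complex.norm_natCast]
    have : (a : ℝ) * ‖ZZ x ξ i (a - 1) (b + 1) g R s τ p‖ ≤ a * (C1 *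
      (((1 + ‖p.1‖) ^ (m + 1))⁻¹ * gau n s (‖p.2‖ ^ 2))) := by gcongr
    linarith

lemma II_tendsto {n m : ℕ} (x : Ep n m) {ξ : EuclideanSpace ℝ (Fin n)} (hξ : ‖ξ‖ = 1)
    (i : Fin n) (a b : ℕ) {g : Ep n m → ℂ} {ρ : ℝ} (hg : SC ρ g) (hρ : ‖x.1‖ + 1 ≤ ρ)
    {s σ : ℝ} (hs : 0 < s) (hσ : |σ| ≤ 1) :
    Tendsto (fun R => II x ξ i a b g R s σ) (nhdsWithin 0 (Ioi 0))
      (nhds (II x ξ i a b g 0 s σ)) := by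
  obtain ⟨C, hC, hb⟩ := ZZ_bound x hξ i a b hg hρ
  have hsmall : ∀ᶠ R in nhdsWithin (0 : ℝ) (Ioi 0), 0 ≤ R ∧ R * ρ ≤ 1 / 5 := by
    have h1 : ∀ᶠ R in nhdsWithin (0 : ℝ) (Ioi 0), (0 : ℝ) < R := self_mem_nhdsWithin
    have h2 : ∀ᶠ R in nhdsWithin (0 : ℝ) (Ioi 0), R * ρ < 1 / 5 := by
      refine Filter.Eventually.filter_mono nhdsWithin_le_nhds ?_
      have : Tendsto (fun R : ℝ => R * ρ) (nhds 0) (nhds (0 * ρ)) :=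
        (continuous_mul_const ρ).continuousAt
      exact this.eventually (gt_mem_nhds (by norm_num))
    filter_upwards [h1, h2] with R a b using ⟨a.le, b.le⟩
  unfold II
  refine tendsto_integral_filter_of_dominated_convergence _ ?_ ?_
    ((integrable_dom n m hs).const_mul C) ?_
  · exact Eventually.of_forall fun R => (ZZ_meas' x ξ i a b hg R s σ).aestronglyMeasurable
  · filter_upwards [hsmall] with R hR
    exact ae_of_all _ fun p => hb R s σ p hR.1 hR.2 hs hσ
  · refine ae_of_all _ fun p => ?_
    have t1 := tendsto_bet (s := s) (r := ‖p.1‖)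
    have t2 := tendsto_kr (n := n) (s := s) (r := ‖p.1‖) (q := ‖p.2‖ ^ 2) hs
    have t0 : Tendsto (fun R : ℝ => R) (nhdsWithin 0 (Ioi 0)) (nhds 0) :=
      tendsto_id.mono_left nhdsWithin_le_nhds
    have t3 : Tendsto (fun R => ql x ξ i R σ p.2) (nhdsWithin 0 (Ioi 0))
        (nhds (ql x ξ i 0 σ p.2)) := by
      have : Continuous (fun R => ql x ξ i R σ p.2) := by unfold ql; fun_prop
      exact this.continuousAt.mono_left nhdsWithin_le_nhds
    have t4 : Tendsto (fun R => qq x ξ i R σ p.2) (nhdsWithin 0 (Ioi 0))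
        (nhds (qq x ξ i 0 σ p.2)) := by
      have : Continuous (fun R => qq x ξ i R σ p.2) := by unfold qq; fun_prop
      exact this.continuousAt.mono_left nhdsWithin_le_nhds
    unfold ZZ
    have u1 := ((Complex.continuous_ofReal.tendsto _).comp (t2.mul_const (Real.exp (p.2 i))))
    have u2 := ((Complex.continuous_ofReal.tendsto _).comp (((((t1.mul t0).mul t3).pow a).mul
      (((t1.mul t0).mul (t0.const_mul 2)).pow b)).mul
      ((Real.continuous_exp.tendsto _).comp (t1.mul t4).neg)))
    exact ((u1.mul_const _).mul u2).mul_const _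

lemma II_meas {n m : ℕ} (x : Ep n m) (ξ : EuclideanSpace ℝ (Fin n)) (i : Fin n)
    (a b : ℕ) {g : Ep n m → ℂ} {ρ : ℝ} (hg : SC ρ g) (R σ : ℝ) :
    StronglyMeasurable (fun s => II x ξ i a b g R s σ) := by
  unfold II
  exact (ZZ_meas x ξ i a b hg R σ).stronglyMeasurable.integral_prod_right

lemma JJ_bound {n m : ℕ} (x : Ep n m) {ξ : EuclideanSpace ℝ (Fin n)} (hξ : ‖ξ‖ = 1) (i : Fin n)
    {ρ : ℝ} (hρ : ‖x.1‖ + 1 ≤ ρ) (k : ℕ) : ∀ (a b : ℕ) {g : Ep n m → ℂ}, SC ρ g →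
    ∃ C, 0 ≤ C ∧ ∀ R s σ, 0 ≤ R → R * ρ ≤ 1 / 5 → 0 < s → |σ| ≤ 1 →
      ‖JJ x ξ i k a b g R s σ‖ ≤ C := by
  induction k with
  | zero => intro a b g hg; exact II_bound x hξ i a b hg hρ
  | succ k ih =>
    intro a b g hg
    obtain ⟨C1, hC1, hb1⟩ := ih (a - 1) (b + 1) hg
    obtain ⟨C2, hC2, hb2⟩ := ih (a + 1) b hg
    obtain ⟨C3, hC3, hb3⟩ := ih a b (hg.pdx1 i)
    refine ⟨a * C1 + C2 + C3, by positivity, fun R s σ hR hRρ hs hσ => ?_⟩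
    have e1 := hb1 R s σ hR hRρ hs hσ
    have e2 := hb2 R s σ hR hRρ hs hσ
    have e3 := hb3 R s σ hR hRρ hs hσ
    rw [JJ]
    refine (norm_add_le _ _).trans (add_le_add ((norm_sub_le _ _).trans (add_le_add ?_ e2)) e3)
    rw [norm_mul, Complex.norm_natCast]
    gcongr

lemma JJ_hasDerivAt {n m : ℕ} (x : Ep n m) {ξ : EuclideanSpace ℝ (Fin n)} (hξ : ‖ξ‖ = 1)
    (i : Fin n) {ρ : ℝ} (hρ : ‖x.1‖ + 1 ≤ ρ) (k : ℕ) {R s σ : ℝ} (hR : 0 ≤ R)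
    (hRρ : R * ρ ≤ 1 / 5) (hs : 0 < s) (hσ : |σ| < 1) : ∀ (a b : ℕ) {g : Ep n m → ℂ}, SC ρ g →
    HasDerivAt (fun σ => JJ x ξ i k a b g R s σ) (JJ x ξ i (k + 1) a b g R s σ) σ := by
  induction k with
  | zero => intro a b g hg; exact II_hasDerivAt x hξ i a b hg hρ hR hRρ hs hσ
  | succ k ih =>
    intro a b g hg
    change HasDerivAt (fun σ => (a : ℂ) * JJ x ξ i k (a - 1) (b + 1) g R s σ
      - JJ x ξ i k (a + 1) b g R s σ + JJ x ξ i k a b (pdx1 i g) R s σ)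
      ((a : ℂ) * JJ x ξ i (k + 1) (a - 1) (b + 1) g R s σ
      - JJ x ξ i (k + 1) (a + 1) b g R s σ + JJ x ξ i (k + 1) a b (pdx1 i g) R s σ) σ
    exact (((ih (a - 1) (b + 1) hg).const_mul _).sub (ih (a + 1) b hg)).add
      (ih a b (hg.pdx1 i))

lemma JJ_tendsto {n m : ℕ} (x : Ep n m) {ξ : EuclideanSpace ℝ (Fin n)} (hξ : ‖ξ‖ = 1)
    (i : Fin n) {ρ : ℝ} (hρ : ‖x.1‖ + 1 ≤ ρ) (k : ℕ) {s σ : ℝ} (hs : 0 < s) (hσ : |σ| ≤ 1) :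
    ∀ (a b : ℕ) {g : Ep n m → ℂ}, SC ρ g →
    Tendsto (fun R => JJ x ξ i k a b g R s σ) (nhdsWithin 0 (Ioi 0))
      (nhds (JJ x ξ i k a b g 0 s σ)) := by
  induction k with
  | zero => intro a b g hg; exact II_tendsto x hξ i a b hg hρ hs hσ
  | succ k ih =>
    intro a b g hg
    simp only [JJ]
    exact (((ih (a - 1) (b + 1) hg).const_mul _).sub (ih (a + 1) b hg)).add
      (ih a b (hg.pdx1 i))

lemma JJ_meas {n m : ℕ} (x : Ep n m) (ξ : EuclideanSpace ℝ (Fin n)) (i : Fin n) {ρ : ℝ} (R σ : ℝ)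
    (k : ℕ) : ∀ (a b : ℕ) {g : Ep n m → ℂ}, SC ρ g →
    StronglyMeasurable (fun s => JJ x ξ i k a b g R s σ) := by
  induction k with
  | zero => intro a b g hg; exact II_meas x ξ i a b hg R σ
  | succ k ih =>
    intro a b g hg
    simp only [JJ]
    exact (((ih (a - 1) (b + 1) hg).const_mul _).sub (ih (a + 1) b hg)).add
      (ih a b (hg.pdx1 i))

lemma iteratedDeriv_II {n m : ℕ} (x : Ep n m) {ξ : EuclideanSpace ℝ (Fin n)} (hξ : ‖ξ‖ = 1)
    (i : Fin n) {ρ : ℝ} (hρ : ‖x.1‖ + 1 ≤ ρ) {R s : ℝ} (hR : 0 ≤ R)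
    (hRρ : R * ρ ≤ 1 / 5) (hs : 0 < s) {g : Ep n m → ℂ} (hg : SC ρ g) (c : ℂ) (φ : ℝ → ℂ)
    (hφ : ∀ σ, |σ| < 1 → φ σ = c * II x ξ i 0 0 g R s σ) (k : ℕ) :
    ∀ σ, |σ| < 1 → iteratedDeriv k φ σ = c * JJ x ξ i k 0 0 g R s σ := by
  induction k with
  | zero => intro σ hσ; simpa [JJ] using hφ σ hσ
  | succ k ih =>
    intro σ hσ
    rw [iteratedDeriv_succ]
    have hnh : {τ : ℝ | |τ| < 1} ∈ nhds σ :=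
      (isOpen_lt continuous_abs continuous_const).mem_nhds hσ
    have : iteratedDeriv k φ =ᶠ[nhds σ] fun σ => c * JJ x ξ i k 0 0 g R s σ := by
      filter_upwards [hnh] with τ hτ using ih τ hτ
    rw [this.deriv_eq]
    exact ((JJ_hasDerivAt x hξ i hρ k hR hRρ hs hσ 0 0 hg).const_mul c).deriv

/-! ## The Fubini identity -/

/-- The rescaled kernel in the variables `(w, μ)`. -/
def KK {n m : ℕ} (x : Ep n m) (ξ : EuclideanSpace ℝ (Fin n)) (i : Fin n) (R s σ : ℝ)
    (w : Ep n m) (μ : EuclideanSpace ℝ (Fin m)) : ℂ :=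
  ((kr n R s ‖μ‖ (‖pt x i σ - w.1‖ ^ 2) * Real.exp (w.1 i - pt x i σ i) *
    Real.exp (-(bet R s ‖μ‖ * inner ℝ (R • pt x i σ + ξ) (R • w.1 + ξ))) : ℝ) : ℂ) *
    Complex.exp (-Complex.I * ((dotp μ (x.2 - w.2) : ℝ) : ℂ))

lemma KK_meas {n m : ℕ} (x : Ep n m) (ξ : EuclideanSpace ℝ (Fin n)) (i : Fin n) (R s σ : ℝ) :
    Measurable (fun t : Ep n m × EuclideanSpace ℝ (Fin m) => KK x ξ i R s σ t.1 t.2) := by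
  have hk := measurable_kr (α := Ep n m × EuclideanSpace ℝ (Fin m))
    (n := n) (R := R) (s := fun t => s) (r := fun t => ‖t.2‖)
    (q := fun t => ‖pt x i σ - t.1.1‖ ^ 2)
    (by fun_prop) (by fun_prop) (by fun_prop)
  have hbt := measurable_bet (α := Ep n m × EuclideanSpace ℝ (Fin m))
    (R := R) (s := fun t => s) (r := fun t => ‖t.2‖) (by fun_prop) (by fun_prop)
  have hd : Measurable (fun t : Ep n m × EuclideanSpace ℝ (Fin m) =>
      dotp t.2 (x.2 - t.1.2)) := (continuous_dotp (by fun_prop) (by fun_prop)).measurable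
  have hi : Measurable (fun t : Ep n m × EuclideanSpace ℝ (Fin m) => t.1.1 i) := by fun_prop
  unfold KK
  fun_prop

lemma KK_bound {n m : ℕ} (x : Ep n m) {ξ : EuclideanSpace ℝ (Fin n)} (hξ : ‖ξ‖ = 1) (i : Fin n)
    {ρ : ℝ} (hρ : ‖x.1‖ + 1 ≤ ρ) {R s σ : ℝ} (hR : 0 ≤ R) (hRρ : R * ρ ≤ 1 / 5)
    (hs : 0 < s) (hσ : |σ| ≤ 1) (w : Ep n m) (hw : ‖w‖ ≤ ρ) (μ : EuclideanSpace ℝ (Fin m)) :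
    ‖KK x ξ i R s σ w μ‖ ≤ ((4 * π * s)⁻¹) ^ ((n : ℝ) / 2) * Real.exp (2 * ρ) *
      Real.exp (-(bet R s ‖μ‖ / 2)) := by
  have hw1 : ‖w.1‖ ≤ ρ := (norm_fst_le w).trans hw
  have hp := norm_pt x i hρ hσ
  have hq := qq_lower x hξ i hR hRρ hρ hσ (v := w.1 - pt x i σ) (by simpa using hw1)
  unfold qq at hq
  rw [add_sub_cancel] at hq
  have h3 := bet_nonneg hR hs (norm_nonneg μ)
  have k0 := kr_nonneg (n := n) (q := ‖pt x i σ - w.1‖ ^ 2) hR hs (norm_nonneg μ)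
  have k1 := kr_le (n := n) (q := ‖pt x i σ - w.1‖ ^ 2) hR hs (norm_nonneg μ) (by positivity)
  have k2 : gau n s (‖pt x i σ - w.1‖ ^ 2) ≤ ((4 * π * s)⁻¹) ^ ((n : ℝ) / 2) := by
    unfold gau
    refine mul_le_of_le_one_right (by positivity) ?_
    rw [Real.exp_le_one_iff, neg_nonpos]
    positivity
  have e1 : |w.1 i| ≤ ‖w.1‖ := by simpa using PiLp.norm_apply_le w.1 i
  have e2 : |pt x i σ i| ≤ ‖pt x i σ‖ := by simpa using PiLp.norm_apply_le (pt x i σ) i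
  have e3 : w.1 i - pt x i σ i ≤ 2 * ρ := by
    linarith [le_abs_self (w.1 i), neg_abs_le (pt x i σ i)]
  rw [KK, norm_mul, norm_exp_neg_I_mul, mul_one, Complex.norm_real,
    Real.norm_of_nonneg (by positivity)]
  have e4 : -(bet R s ‖μ‖ * inner ℝ (R • pt x i σ + ξ) (R • w.1 + ξ)) ≤ -(bet R s ‖μ‖ / 2) := by
    nlinarith
  gcongr
  exact k1.trans k2

lemma SC.integrable {n m : ℕ} {ρ : ℝ} {g : Ep n m → ℂ} (h : SC ρ g) : Integrable g := by
  refine h.continuous.integrable_of_hasCompactSupport ?_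
  refine HasCompactSupport.intro (isCompact_closedBall (0 : Ep n m) ρ) fun w hw => h.supp w ?_
  simpa using hw

lemma KK_integrable {n m : ℕ} (x : Ep n m) {ξ : EuclideanSpace ℝ (Fin n)} (hξ : ‖ξ‖ = 1)
    (i : Fin n) {g : Ep n m → ℂ} {ρ : ℝ} (hg : SC ρ g)
    (hρ : ‖x.1‖ + 1 ≤ ρ) {R s σ : ℝ} (hR : 0 ≤ R) (hRρ : R * ρ ≤ 1 / 5)
    (hs : 0 < s) (hσ : |σ| ≤ 1) :
    Integrable (fun t : Ep n m × EuclideanSpace ℝ (Fin m) => g t.1 * KK x ξ i R s σ t.1 t.2) := by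
  have h1 := ((hg.integrable.norm).mul_prod (integrable_exp_bet m hR hs)).const_mul
    (((4 * π * s)⁻¹) ^ ((n : ℝ) / 2) * Real.exp (2 * ρ))
  refine Integrable.mono' h1 ?_ (ae_of_all _ fun t => ?_)
  · have := hg.continuous.measurable
    exact ((this.comp measurable_fst).mul (KK_meas x ξ i R s σ)).aestronglyMeasurable
  · by_cases hw : ‖t.1‖ ≤ ρ
    · have := KK_bound x hξ i hρ hR hRρ hs hσ t.1 hw t.2
      rw [norm_mul]
      exact (mul_le_mul_of_nonneg_left this (norm_nonneg (g t.1))).trans (le_of_eq (by ring))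
    · rw [hg.supp _ (not_le.1 hw)]; simp

lemma KK_integral {n m : ℕ} (x : Ep n m) {ξ : EuclideanSpace ℝ (Fin n)} (hξ : ‖ξ‖ = 1)
    (i : Fin n) {g : Ep n m → ℂ} {ρ : ℝ} (hg : SC ρ g)
    (hρ : ‖x.1‖ + 1 ≤ ρ) {R s σ : ℝ} (hR : 0 ≤ R) (hRρ : R * ρ ≤ 1 / 5)
    (hs : 0 < s) (hσ : |σ| ≤ 1) :
    ∫ w : Ep n m, g w * ∫ μ, KK x ξ i R s σ w μ = II x ξ i 0 0 g R s σ := by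
  have hInt := KK_integrable x hξ i hg hρ hR hRρ hs hσ
  have h0 : ∫ w : Ep n m, g w * ∫ μ, KK x ξ i R s σ w μ
      = ∫ w : Ep n m, ∫ μ, g w * KK x ξ i R s σ w μ := by
    simp only [integral_const_mul]
  rw [h0, integral_integral_swap hInt, II,
    show (volume : Measure (EuclideanSpace ℝ (Fin m) × EuclideanSpace ℝ (Fin n))) =
      (volume : Measure (EuclideanSpace ℝ (Fin m))).prod volume from rfl,
    integral_prod _ (ZZ_integrable x hξ i 0 0 hg hρ hR hRρ hs hσ)]
  refine integral_congr_ae ?_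
  filter_upwards [hInt.prod_left_ae] with μ hμ
  rw [show (volume : Measure (Ep n m)) =
      (volume : Measure (EuclideanSpace ℝ (Fin n))).prod volume from rfl, integral_prod _ hμ,
    ← integral_add_left_eq_self _ (pt x i σ)]
  refine integral_congr_ae (ae_of_all _ fun v => ?_)
  simp only [ZZ, PF, KK]
  rw [← integral_const_mul]
  refine integral_congr_ae (ae_of_all _ fun z => ?_)
  have e1 : dotp μ (x.2 - z) = dotp μ x.2 - dotp μ z := by
    simp only [dotp_eq_inner, inner_sub_right]
  have e2 : Complex.exp (-Complex.I * ((dotp μ (x.2 - z) : ℝ) : ℂ)) =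
      Complex.exp (-Complex.I * ((dotp μ x.2 : ℝ) : ℂ)) *
        Complex.exp (Complex.I * ((dotp μ z : ℝ) : ℂ)) := by
    rw [e1, ← Complex.exp_add]; congr 1; push_cast; ring
  have e3 : ‖pt x i σ - (pt x i σ + v)‖ = ‖v‖ := by simp
  have e4 : (pt x i σ + v) i - pt x i σ i = v i := by simp
  simp only [e2, e3, e4, qq, pow_zero, one_mul]
  push_cast
  ring

/-! ## Identification of the heat operators -/

lemma hermite_scale {n : ℕ} {m : ℕ} {R s : ℝ} (hR : 0 < R) (hs : 0 < s)
    {μ : EuclideanSpace ℝ (Fin m)} (hμ : μ ≠ 0) (A B ξ : EuclideanSpace ℝ (Fin n)) :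
    R ^ n * hermiteK n (R ^ 2 * s) (R⁻¹ • μ) (R • A + ξ) (R • B + ξ) =
      kr n R s ‖μ‖ (‖A - B‖ ^ 2) *
        Real.exp (-(bet R s ‖μ‖ * inner ℝ (R • A + ξ) (R • B + ξ))) := by
  have hr : 0 < ‖μ‖ := norm_pos_iff.2 hμ
  have e1 : ‖R⁻¹ • μ‖ = ‖μ‖ / R := by
    rw [norm_smul, Real.norm_of_nonneg (by positivity)]; field_simp
  have e2 : 2 * (‖μ‖ / R) * (R ^ 2 * s) = 2 * ‖μ‖ * R * s := by field_simp
  have e3 : ‖μ‖ / R * (R ^ 2 * s) = ‖μ‖ * R * s := by field_simp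
  have e4 : R • A + ξ - (R • B + ξ) = R • (A - B) := by rw [smul_sub]; abel
  have e5 : ‖R • (A - B)‖ ^ 2 = R ^ 2 * ‖A - B‖ ^ 2 := by
    rw [norm_smul, Real.norm_of_nonneg hR.le]; ring
  have hS := shn_mul (2 * ‖μ‖ * R * s)
  have hpos : 0 < shn (2 * ‖μ‖ * R * s) := shn_pos (by positivity)
  rw [hermiteK, e1, e2, e3, e4, e5, ← hS, dotp_eq_inner, kr]
  have hRn : R ^ n = (R ^ 2) ^ ((n : ℝ) / 2) := by
    rw [← Real.rpow_natCast R 2, ← Real.rpow_mul hR.le, ← Real.rpow_natCast R n]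
    congr 1; push_cast; ring
  rw [← mul_assoc, hRn, ← Real.mul_rpow (by positivity) (by positivity),
    mul_assoc (((4 * π * s)⁻¹ / shn (2 * ‖μ‖ * R * s)) ^ _), ← Real.exp_add]
  have hb : ‖μ‖ / R * Real.tanh (‖μ‖ * R * s) = bet R s ‖μ‖ := by
    have := bet_mul_R (R := R) (s := s) (r := ‖μ‖)
    field_simp
    linarith
  rw [hb]
  generalize shn (2 * ‖μ‖ * R * s) = S at *
  congr 2
  · field_simp; ring
  · field_simp; ring

lemma integral_affine {n m : ℕ} {R : ℝ} (hR : 0 < R) (ξ : Ep n m) (F : Ep n m → ℂ) :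
    ∫ y, F y = ((R ^ (n + m) : ℝ) : ℂ) * ∫ w : Ep n m, F (R • w + ξ) := by
  have inst : (volume : Measure (Ep n m)).IsAddHaarMeasure := by
    change ((volume : Measure (EuclideanSpace ℝ (Fin n))).prod
      (volume : Measure (EuclideanSpace ℝ (Fin m)))).IsAddHaarMeasure
    infer_instance
  have h1 := Measure.integral_comp_smul_of_nonneg (volume : Measure (Ep n m))
    (fun y => F (y + ξ)) R (hR := hR.le)
  have h2 := integral_add_right_eq_self (μ := (volume : Measure (Ep n m))) F ξ
  have h3 : Module.finrank ℝ (Ep n m) = n + m := by simp [Ep]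
  rw [h1, h2, h3, Complex.real_smul, ← mul_assoc, ← Complex.ofReal_mul,
    mul_inv_cancel₀ (by positivity)]
  simp

lemma heatOp_eq {n m : ℕ} (hm : 0 < m) (x : Ep n m) {ξ : Ep n m} (hξ : ‖ξ.1‖ = 1)
    (i : Fin n) {g : Ep n m → ℂ} {ρ : ℝ} (hg : SC ρ g)
    (hρ : ‖x.1‖ + 1 ≤ ρ) {R s σ : ℝ} (hR : 0 < R) (hRρ : R * ρ ≤ 1 / 5)
    (hs : 0 < s) (hσ : |σ| ≤ 1) :
    heatOp (R⁻¹ • EuclideanSpace.single i 1) (R ^ 2 * s)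
      (fun z => g (R⁻¹ • (z.1 - ξ.1), R⁻¹ • (z.2 - ξ.2)))
      (R • pt x i σ + ξ.1, R • x.2 + ξ.2) =
    ((Real.exp (-s) * ((2 * π) ^ m)⁻¹ : ℝ) : ℂ) * II x ξ.1 i 0 0 g R s σ := by
  have : Nonempty (Fin m) := ⟨⟨0, hm⟩⟩
  rw [← KK_integral x hξ i hg hρ hR.le hRρ hs hσ, heatOp, integral_affine hR ξ,
    ← integral_const_mul, ← integral_const_mul]
  refine integral_congr_ae (ae_of_all _ fun w => ?_)
  have hd : ∀ z : EuclideanSpace ℝ (Fin n),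
      dotp (R⁻¹ • EuclideanSpace.single i (1 : ℝ)) z = R⁻¹ * z i := by
    intro z
    simp [dotp_eq_inner, inner_smul_left, EuclideanSpace.inner_single_left]
  have hna : ‖(R⁻¹ • EuclideanSpace.single i (1 : ℝ) : EuclideanSpace ℝ (Fin n))‖ = R⁻¹ := by
    rw [norm_smul, Real.norm_of_nonneg (by positivity)]; simp
  have hμ : ∀ᵐ μ : EuclideanSpace ℝ (Fin m), μ ≠ 0 := by
    rw [ae_iff]; simp
  have hK : ((R ^ (n + m) : ℝ) : ℂ) * ((Real.exp (w.1 i - pt x i σ i) : ℝ) : ℂ) *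
      ∫ lam : EuclideanSpace ℝ (Fin m),
        ((hermiteK n (R ^ 2 * s) lam (R • pt x i σ + ξ.1) (R • w.1 + ξ.1) : ℝ) : ℂ) *
        Complex.exp (-Complex.I * ((dotp lam ((R • x.2 + ξ.2) - (R • w.2 + ξ.2)) : ℝ) : ℂ)) =
      ∫ μ, KK x ξ.1 i R s σ w μ := by
    have h1 := Measure.integral_comp_inv_smul_of_nonneg
      (volume : Measure (EuclideanSpace ℝ (Fin m))) (fun lam : EuclideanSpace ℝ (Fin m) =>
        ((hermiteK n (R ^ 2 * s) lam (R • pt x i σ + ξ.1) (R • w.1 + ξ.1) : ℝ) : ℂ) *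
        Complex.exp (-Complex.I * ((dotp lam ((R • x.2 + ξ.2) - (R • w.2 + ξ.2)) : ℝ) : ℂ))) hR.le
    rw [finrank_euclideanSpace_fin, Complex.real_smul] at h1
    rw [pow_add, Complex.ofReal_mul]
    have hr : ∀ J : ℂ, ((R ^ n : ℝ) : ℂ) * ((R ^ m : ℝ) : ℂ) *
        ((Real.exp (w.1 i - pt x i σ i) : ℝ) : ℂ) * J = ((R ^ n : ℝ) : ℂ) *
        ((Real.exp (w.1 i - pt x i σ i) : ℝ) : ℂ) * (((R ^ m : ℝ) : ℂ) * J) := fun J => by ring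
    rw [hr, ← h1, ← integral_const_mul]
    refine integral_congr_ae ?_
    filter_upwards [hμ] with μ hμ
    have e := hermite_scale (n := n) hR hs hμ (pt x i σ) w.1 ξ.1
    have e2 : dotp (R⁻¹ • μ) (R • x.2 + ξ.2 - (R • w.2 + ξ.2)) = dotp μ (x.2 - w.2) := by
      rw [dotp_eq_inner, dotp_eq_inner, inner_smul_left,
        show R • x.2 + ξ.2 - (R • w.2 + ξ.2) = R • (x.2 - w.2) by rw [smul_sub]; abel,
        inner_smul_right]
      simp only [conj_trivial]
      field_simp
    rw [KK, e2, mul_right_comm (kr n R s ‖μ‖ _), ← e]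
    push_cast
    ring
  beta_reduce
  rw [← hK]
  have hw1 : R⁻¹ • ((R • w + ξ).1 - ξ.1) = w.1 := by
    simp [smul_smul, inv_mul_cancel₀ hR.ne']
  have hw2 : R⁻¹ • ((R • w + ξ).2 - ξ.2) = w.2 := by
    simp [smul_smul, inv_mul_cancel₀ hR.ne']
  have hexp : Real.exp (-‖(R⁻¹ • EuclideanSpace.single i (1 : ℝ) : EuclideanSpace ℝ (Fin n))‖ ^ 2 *
      (R ^ 2 * s)) * Real.exp (-dotp (R⁻¹ • EuclideanSpace.single i (1 : ℝ))
        ((R • pt x i σ + ξ.1) + (R • w + ξ).1)) *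
      Real.exp (2 * dotp (R⁻¹ • EuclideanSpace.single i (1 : ℝ)) (R • w + ξ).1) =
      Real.exp (-s) * Real.exp (w.1 i - pt x i σ i) := by
    rw [← Real.exp_add, ← Real.exp_add, ← Real.exp_add, hd, hd, hna]
    congr 1
    simp only [Prod.fst_add, Prod.smul_fst, PiLp.add_apply, PiLp.smul_apply, smul_eq_mul]
    field_simp
    ring
  simp only [hw1, hw2, driftH, grushinH]
  have hexp' := congrArg (fun t : ℝ => (t : ℂ)) hexp
  simp only [Complex.ofReal_mul] at hexp'
  simp only [Complex.ofReal_mul]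
  simp only [Prod.fst_add, Prod.smul_fst, Prod.snd_add, Prod.smul_snd] at hexp' ⊢
  generalize (∫ lam : EuclideanSpace ℝ (Fin m), _ : ℂ) = J
  linear_combination ((R ^ (n + m) : ℝ) : ℂ) * ((((2 * π) ^ m)⁻¹ : ℝ) : ℂ) * J * g w * hexp'

lemma euclHeat_eq {n m : ℕ} (x : Ep n m) {ξ : EuclideanSpace ℝ (Fin n)} (hξ : ‖ξ‖ = 1)
    (i : Fin n) {g : Ep n m → ℂ} {ρ : ℝ} (hg : SC ρ g)
    (hρ : ‖x.1‖ + 1 ≤ ρ) {s σ : ℝ} (hs : 0 < s) (hσ : |σ| ≤ 1) :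
    euclHeat i s g (pt x i σ, x.2) =
    ((Real.exp (-s) * ((2 * π) ^ m)⁻¹ : ℝ) : ℂ) * II x ξ i 0 0 g 0 s σ := by
  rw [← KK_integral x hξ i hg hρ le_rfl (by norm_num) hs hσ, euclHeat,
    ← integral_const_mul, ← integral_const_mul]
  refine integral_congr_ae (ae_of_all _ fun w => ?_)
  have hJ : ∫ μ, KK x ξ i 0 s σ w μ =
      ((gau n s (‖pt x i σ - w.1‖ ^ 2) * Real.exp (w.1 i - pt x i σ i) *
        ((π / s) ^ ((m : ℝ) / 2) * Real.exp (-‖x.2 - w.2‖ ^ 2 / (4 * s))) : ℝ) : ℂ) := by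
    have h := GaussianFourier.integral_cexp_neg_mul_sq_norm_add (V := EuclideanSpace ℝ (Fin m))
      (b := (s : ℂ)) (by simpa using hs) (-Complex.I) (x.2 - w.2)
    rw [finrank_euclideanSpace_fin] at h
    have h2 : ((π : ℂ) / (s : ℂ)) ^ ((m : ℂ) / 2) = (((π / s) ^ ((m : ℝ) / 2) : ℝ) : ℂ) := by
      rw [Complex.ofReal_cpow (by positivity)]; push_cast; rfl
    have h3 : Complex.exp ((-Complex.I) ^ 2 * (‖x.2 - w.2‖ : ℂ) ^ 2 / (4 * (s : ℂ))) =
        ((Real.exp (-‖x.2 - w.2‖ ^ 2 / (4 * s)) : ℝ) : ℂ) := by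
      push_cast; congr 1; simp
    rw [h2, h3] at h
    rw [Complex.ofReal_mul, Complex.ofReal_mul ((π / s) ^ _), ← h, ← integral_const_mul]
    refine integral_congr_ae (ae_of_all _ fun μ => ?_)
    have hin : inner ℝ ((0 : ℝ) • pt x i σ + ξ) ((0 : ℝ) • w.1 + ξ) = 1 := by
      simp [hξ]
    simp only [KK, kr_zero, bet_zero]
    rw [hin, Complex.ofReal_mul, mul_assoc, Complex.ofReal_exp, ← Complex.exp_add,
      dotp_eq_inner, real_inner_comm]
    congr 2
    push_cast
    ring
  dsimp only
  rw [hJ]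
  have hpow : (4 * π * s) ^ (-(((n : ℝ) + (m : ℝ)) / 2)) =
      ((4 * π * s)⁻¹) ^ ((n : ℝ) / 2) * (((2 * π) ^ m)⁻¹ * (π / s) ^ ((m : ℝ) / 2)) := by
    have e1 : ((2 * π) ^ m)⁻¹ = (((2 * π) ^ 2)⁻¹) ^ ((m : ℝ) / 2) := by
      rw [Real.inv_rpow (by positivity), ← Real.rpow_natCast (2 * π) 2,
        ← Real.rpow_mul (by positivity), ← Real.rpow_natCast (2 * π) m]
      congr 2; push_cast; ring
    rw [e1, ← Real.mul_rpow (by positivity) (by positivity), Real.rpow_neg (by positivity),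
      ← Real.inv_rpow (by positivity), add_div, Real.rpow_add (by positivity)]
    congr 2
    field_simp
    ring
  simp only [gau]
  rw [hpow]
  have hexp : Real.exp (-s) * Real.exp (-(pt x i σ i) - w.1 i) *
          Real.exp (-(‖pt x i σ - w.1‖ ^ 2 + ‖x.2 - w.2‖ ^ 2) / (4 * s)) *
            Real.exp (2 * w.1 i) = Real.exp (-s) * Real.exp (w.1 i - pt x i σ i) *
      Real.exp (-((4 * s)⁻¹ * ‖pt x i σ - w.1‖ ^ 2)) * Real.exp (-‖x.2 - w.2‖ ^ 2 / (4 * s)) := by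
    rw [← Real.exp_add, ← Real.exp_add, ← Real.exp_add, ← Real.exp_add, ← Real.exp_add,
      ← Real.exp_add]
    congr 1
    field_simp
    ring
  have hexp' := congrArg (fun t : ℝ => (t : ℂ)) hexp
  simp only at hexp'
  rw [hexp']
  push_cast
  ring

/-! ## Assembling the pieces -/

lemma pdx1_iter {n m : ℕ} (i : Fin n) (k : ℕ) : ∀ (h : Ep n m → ℂ) (x : Ep n m),
    (pdx1 i)^[k] h x =
      iteratedDeriv k (fun τ : ℝ => h (x.1 + τ • EuclideanSpace.single i (1 : ℝ), x.2)) 0 := by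
  induction k with
  | zero => intro h x; simp
  | succ k ih =>
    intro h x
    rw [Function.iterate_succ_apply, ih, iteratedDeriv_succ']
    congr 1
    funext τ
    unfold pdx1
    have := deriv_comp_const_add
      (fun τ : ℝ => h (x.1 + τ • EuclideanSpace.single i (1 : ℝ), x.2)) τ 0
    rw [add_zero] at this
    rw [← this]
    congr 1
    funext s
    simp only [add_smul, add_assoc]

lemma iteratedDeriv_scale (c : ℝ) (F : ℝ → ℂ) (k : ℕ) :
    iteratedDeriv k (fun σ => F (c * σ)) = fun σ => (c : ℂ) ^ k * iteratedDeriv k F (c * σ) := by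
  induction k with
  | zero => simp
  | succ k ih =>
    rw [iteratedDeriv_succ, ih]
    funext σ
    have h1 := deriv_const_mul_field (𝕜 := ℝ) (x := σ) ((c : ℂ) ^ k)
      (v := fun σ => iteratedDeriv k F (c * σ))
    rw [h1, deriv_comp_mul_left c (iteratedDeriv k F) σ, iteratedDeriv_succ, Complex.real_smul]
    ring

/-- The common form of both Riesz transforms. -/
def LL {n m : ℕ} (x : Ep n m) (ξ : EuclideanSpace ℝ (Fin n)) (i : Fin n) (k : ℕ)
    (g : Ep n m → ℂ) (R : ℝ) : ℂ :=
  ∫ s in Set.Ioi (0 : ℝ), ((s ^ (((k : ℝ) / 2) - 1) : ℝ) : ℂ) *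
    (((Real.exp (-s) * ((2 * π) ^ m)⁻¹ : ℝ) : ℂ) * JJ x ξ i k 0 0 g R s 0)

lemma rieszPd1_eq {n m : ℕ} (hm : 0 < m) (x : Ep n m) {ξ : Ep n m} (hξ : ‖ξ.1‖ = 1)
    (i : Fin n) (k : ℕ) {g : Ep n m → ℂ} {ρ : ℝ} (hg : SC ρ g)
    (hρ : ‖x.1‖ + 1 ≤ ρ) {R : ℝ} (hR : 0 < R) (hRρ : R * ρ ≤ 1 / 5) :
    rieszPd1 (R⁻¹ • EuclideanSpace.single i 1) i k
      (fun z => g (R⁻¹ • (z.1 - ξ.1), R⁻¹ • (z.2 - ξ.2)))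
      (R • x.1 + ξ.1, R • x.2 + ξ.2) =
    ((Real.Gamma ((k : ℝ) / 2))⁻¹ : ℝ) * LL x ξ.1 i k g R := by
  rw [rieszPd1, LL]
  congr 1
  have hs := integral_comp_mul_left_Ioi' (fun t : ℝ => ((t ^ (((k : ℝ) / 2) - 1) : ℝ) : ℂ) *
    (pdx1 i)^[k] (heatOp (R⁻¹ • EuclideanSpace.single i 1) t
      (fun z => g (R⁻¹ • (z.1 - ξ.1), R⁻¹ • (z.2 - ξ.2))))
      (R • x.1 + ξ.1, R • x.2 + ξ.2)) 0 (b := R ^ 2) (by positivity)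
  rw [mul_zero] at hs
  rw [← hs, Complex.real_smul, ← integral_const_mul]
  refine setIntegral_congr_fun measurableSet_Ioi fun s hs => ?_
  have hs : 0 < s := hs
  beta_reduce
  rw [pdx1_iter]
  generalize hF : (fun τ : ℝ => heatOp (R⁻¹ • EuclideanSpace.single i 1) (R ^ 2 * s)
      (fun z => g (R⁻¹ • (z.1 - ξ.1), R⁻¹ • (z.2 - ξ.2)))
      ((R • x.1 + ξ.1, R • x.2 + ξ.2).1 + τ • EuclideanSpace.single i (1 : ℝ),
        (R • x.1 + ξ.1, R • x.2 + ξ.2).2)) = F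
  have h1 := iteratedDeriv_II x hξ i hρ hR.le hRρ hs hg
    ((Real.exp (-s) * ((2 * π) ^ m)⁻¹ : ℝ) : ℂ) (fun σ => F (R * σ)) (fun σ hσ => by
      rw [← heatOp_eq hm x hξ i hg hρ hR hRρ hs hσ.le, ← hF]
      simp only [pt, smul_add, smul_smul]
      congr 2
      abel) k 0 (by simp)
  rw [iteratedDeriv_scale] at h1
  simp only [mul_zero] at h1
  rw [← h1]
  have h2 : R ^ 2 * (R ^ 2 * s) ^ ((k : ℝ) / 2 - 1) = s ^ ((k : ℝ) / 2 - 1) * R ^ k := by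
    rw [Real.mul_rpow (by positivity) hs.le, Real.rpow_sub_one (by positivity),
      ← Real.rpow_natCast R 2, ← Real.rpow_mul hR.le, ← Real.rpow_natCast R k]
    rw [show (((2 : ℕ) : ℝ) * ((k : ℝ) / 2)) = k by push_cast; ring]
    have : R ^ (((2 : ℕ) : ℝ)) ≠ 0 := by positivity
    field_simp
  have h3 := congrArg (fun t : ℝ => (t : ℂ)) h2
  simp only [Complex.ofReal_mul] at h3
  rw [← mul_assoc, h3]
  push_cast
  ring

lemma euclRiesz_eq {n m : ℕ} (x : Ep n m) {ξ : EuclideanSpace ℝ (Fin n)} (hξ : ‖ξ‖ = 1)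
    (i : Fin n) (k : ℕ) {g : Ep n m → ℂ} {ρ : ℝ} (hg : SC ρ g) (hρ : ‖x.1‖ + 1 ≤ ρ) :
    euclRiesz i k g x = ((Real.Gamma ((k : ℝ) / 2))⁻¹ : ℝ) * LL x ξ i k g 0 := by
  rw [euclRiesz, LL]
  congr 1
  refine setIntegral_congr_fun measurableSet_Ioi fun s hs => ?_
  have hs : 0 < s := hs
  beta_reduce
  rw [pdx1_iter]
  congr 1
  exact iteratedDeriv_II x hξ i hρ le_rfl (by norm_num) hs hg
    ((Real.exp (-s) * ((2 * π) ^ m)⁻¹ : ℝ) : ℂ) _ (fun σ hσ =>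
      euclHeat_eq x hξ i hg hρ hs hσ.le) k 0 (by simp)

lemma LL_tendsto {n m : ℕ} (x : Ep n m) {ξ : EuclideanSpace ℝ (Fin n)} (hξ : ‖ξ‖ = 1)
    (i : Fin n) {k : ℕ} (hk : 1 ≤ k) {g : Ep n m → ℂ} {ρ : ℝ} (hg : SC ρ g)
    (hρ : ‖x.1‖ + 1 ≤ ρ) (hsmall : ∀ᶠ R in nhdsWithin (0 : ℝ) (Ioi 0), 0 < R ∧ R * ρ ≤ 1 / 5) :
    Tendsto (LL x ξ i k g) (nhdsWithin 0 (Ioi 0)) (nhds (LL x ξ i k g 0)) := by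
  obtain ⟨C, hC, hb⟩ := JJ_bound x hξ i hρ k 0 0 hg
  have hk' : 0 < (k : ℝ) / 2 := by positivity
  unfold LL
  refine tendsto_integral_filter_of_dominated_convergence
    (fun s => Real.exp (-s) * s ^ ((k : ℝ) / 2 - 1) * (((2 * π) ^ m)⁻¹ * C)) ?_ ?_
    ((Real.GammaIntegral_convergent hk').mul_const _) ?_
  · refine Eventually.of_forall fun R => ?_
    have h1 := (JJ_meas x ξ i R 0 k 0 0 hg).measurable
    refine Measurable.aestronglyMeasurable ?_
    fun_prop
  · filter_upwards [hsmall] with R hR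
    refine (ae_restrict_iff' measurableSet_Ioi).2 (ae_of_all _ fun s hs => ?_)
    have hs : 0 < s := hs
    have := hb R s 0 hR.1.le hR.2 hs (by simp)
    rw [norm_mul, norm_mul, Complex.norm_real, Complex.norm_real,
      Real.norm_of_nonneg (by positivity), Real.norm_of_nonneg (by positivity)]
    calc _ ≤ s ^ ((k : ℝ) / 2 - 1) * (Real.exp (-s) * ((2 * π) ^ m)⁻¹ * C) := by gcongr
      _ = _ := by ring
  · refine (ae_restrict_iff' measurableSet_Ioi).2 (ae_of_all _ fun s hs => ?_)
    exact ((JJ_tendsto x hξ i hρ k hs (by simp) 0 0 hg).const_mul _).const_mul _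

/-- **Theorem (pointwise convergence of rescaled Riesz transforms)**: with
`U f(x) = f(x+ξ)` and `Λ_R f(x) = f(Rx)` (`|ξ'| = |ξ''| = 1`), for every `k ≥ 1`,
`f ∈ C_c^∞(ℝ^{n+m})` and every `x`,
`lim_{R→0⁺} (Λ_R U)(∂^k_{x'_1} (G_{e₁/R})^{-k/2})(Λ_R U)⁻¹ f(x)
  = ∂^k_{x'_1} (Δ_{e₁})^{-k/2} f(x)`. -/
theorem rieszPd1_pointwise_limit (n m : ℕ) (hn : 0 < n) (hm : 0 < m)
    (ξ' : EuclideanSpace ℝ (Fin n)) (ξ'' : EuclideanSpace ℝ (Fin m))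
    (hξ' : ‖ξ'‖ = 1) (hξ'' : ‖ξ''‖ = 1)
    (k : ℕ) (hk : 1 ≤ k)
    (f : Ep n m → ℂ) (hf : ContDiff ℝ (⊤ : ℕ∞) f) (hfc : HasCompactSupport f) (x : Ep n m) :
    Filter.Tendsto
      (fun R : ℝ =>
        rieszPd1 (R⁻¹ • EuclideanSpace.single (⟨0, hn⟩ : Fin n) 1) ⟨0, hn⟩ k
          (fun z => f (R⁻¹ • (z.1 - ξ'), R⁻¹ • (z.2 - ξ'')))
          (R • x.1 + ξ', R • x.2 + ξ''))
      (nhdsWithin 0 (Set.Ioi 0))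
      (nhds (euclRiesz (⟨0, hn⟩ : Fin n) k f x)) := by
  obtain ⟨ρ₀, hρ₀⟩ := hfc.isCompact.isBounded.subset_closedBall (0 : Ep n m)
  obtain ⟨ρ, h1, h2⟩ : ∃ ρ, ρ₀ ≤ ρ ∧ ‖x.1‖ + 1 ≤ ρ :=
    ⟨max ρ₀ (‖x.1‖ + 1), le_max_left _ _, le_max_right _ _⟩
  have hg : SC ρ f := by
    refine ⟨hf, fun w hw => ?_⟩
    by_contra hne
    have := hρ₀ (subset_tsupport f hne)
    rw [mem_closedBall_zero_iff] at this
    linarith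
  have hsmall : ∀ᶠ R in nhdsWithin (0 : ℝ) (Ioi 0), 0 < R ∧ R * ρ ≤ 1 / 5 := by
    have h1 : ∀ᶠ R in nhdsWithin (0 : ℝ) (Ioi 0), (0 : ℝ) < R := self_mem_nhdsWithin
    have h2 : ∀ᶠ R in nhdsWithin (0 : ℝ) (Ioi 0), R * ρ < 1 / 5 := by
      refine Filter.Eventually.filter_mono nhdsWithin_le_nhds ?_
      have : Tendsto (fun R : ℝ => R * ρ) (nhds 0) (nhds (0 * ρ)) :=
        (continuous_mul_const ρ).continuousAt
      exact this.eventually (gt_mem_nhds (by norm_num))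
    filter_upwards [h1, h2] with R a b using ⟨a, b.le⟩
  rw [euclRiesz_eq x hξ' _ k hg h2]
  refine Tendsto.congr' ?_ ((LL_tendsto x hξ' ⟨0, hn⟩ hk hg h2 hsmall).const_mul _)
  filter_upwards [hsmall] with R hR
  exact (rieszPd1_eq hm x (ξ := (ξ', ξ'')) hξ' _ k hg h2 hR.1 hR.2).symm
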